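/- Let k be an algebraically closed field of characteristic zero, let G be an integral algebraic group scheme over k, and let X be an integral algebraic scheme over k with a transitive G-action. Let f: Y → X and g: Z → X be morphisms of integral algebraic schemes over k. For a k-point σ of G, let σY denote Y regarded as an X-scheme via y ↦ σ·f(y). Then there exists a dense open subset U of G such that for every k-point σ of U, the fiber product (σY) ×_X Z is either empty or equidimensional of dimension dim Y + dim Z − dim X. Furthermore, if Y and Z are regular, then there is a dense open subset of G over whose k-points this fiber product is regular. -/

import Mathlib

/-!  **Kleiman's Transversality Theorem.**

Over an algebraically closed field `k` of characteristic zero, let `G` be an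
integral algebraic group scheme acting transitively on an integral algebraic
scheme `X`, and let `f : Y ⟶ X`, `g : Z ⟶ X` be morphisms of integral
algebraic schemes (everything of finite type over `k`).  For a `k`-point `σ`
of `G`, let `σY` be `Y` viewed as an `X`-scheme via `y ↦ σ·f(y)`.  Then for
`σ` in a dense open subset of `G`, the fiber product `(σY) ×_X Z` is empty or
equidimensional of dimension `dim Y + dim Z - dim X`; and if `Y`, `Z` are
regular, it is regular for `σ` in a dense open subset.

The group structure and the action are encoded through their functors of
points: `mul` induces, for every test scheme `T`, a multiplication
`(a, b) ↦ pullback.lift a b _ ≫ mul` on `T`-points of `G` lying over the same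
`k`-structure, and the usual group/action axioms are imposed on these. -/

open CategoryTheory CategoryTheory.Limits AlgebraicGeometry TopologicalSpace

noncomputable section

/-- A commutative ring is a regular local ring if it is Noetherian local and
its maximal ideal is generated by `dim R` elements. -/
def IsRegularLocal (R : Type*) [CommRing R] : Prop :=
  IsNoetherianRing R ∧ ∃ _h : IsLocalRing R, ∃ s : Finset R,
    Ideal.span (s : Set R) = IsLocalRing.maximalIdeal R ∧
    (s.card : WithBot (WithTop ℕ)) = ringKrullDim R

/-- A scheme is regular if all of its stalks are regular local rings. -/
def RegularScheme (W : Scheme) : Prop :=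
  ∀ x : W, IsRegularLocal (W.presheaf.stalk x)

theorem MvPolynomial.height_eq_of_isMaximal (k : Type*) [Field k] (n : ℕ)
    (M : Ideal (MvPolynomial (Fin n) k)) [M.IsMaximal] : M.height = n := by
  induction n with
  | zero =>
    have h := Ideal.height_le_ringKrullDim_of_ne_top (I := M) Ideal.IsPrime.ne_top'
    rw [MvPolynomial.ringKrullDim_of_isNoetherianRing, ringKrullDim_eq_zero_of_field] at h
    simp only [Nat.card_eq_fintype_card, Fintype.card_fin, Nat.cast_zero, add_zero] at h ⊢
    exact le_antisymm (by exact_mod_cast h) bot_le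
  | succ n ih =>
    let e := (MvPolynomial.finSuccEquiv k n).toRingEquiv
    have : (M.map e).IsMaximal := Ideal.map_isMaximal_of_equiv e
    have h1 : (M.map e).height = M.height := RingEquiv.height_map e M
    have : ((M.map e).comap Polynomial.C).IsMaximal :=
      Polynomial.isMaximal_comap_C_of_isJacobsonRing (M.map e)
    have : (M.map e).LiesOver ((M.map e).comap Polynomial.C) := ⟨rfl⟩
    rw [← h1, Polynomial.height_eq_height_add_one ((M.map e).comap Polynomial.C) (M.map e),
      ih]
    simp

/-- All maximal ideals of a domain of finite type over a field have the same height. -/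
theorem Ideal.height_eq_ringKrullDim_of_finiteType (k A : Type*) [Field k] [CommRing A] [IsDomain A]
    [Algebra k A] [Algebra.FiniteType k A] (m : Ideal A) [m.IsMaximal] :
    (m.height : WithBot ℕ∞) = ringKrullDim A := by
  obtain ⟨s, g, hg, hf⟩ := exists_finite_inj_algHom_of_fg k A
  let := g.toRingHom.toAlgebra
  have : Module.Finite (MvPolynomial (Fin s) k) A := hf
  have : IsNoetherianRing A := Algebra.FiniteType.isNoetherianRing k A
  have : FaithfulSMul (MvPolynomial (Fin s) k) A := (faithfulSMul_iff_algebraMap_injective _ _).mpr hg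
  have hd : ringKrullDim A ≤ s := by
    have : ringKrullDim A ≤ ringKrullDim (MvPolynomial (Fin s) k) :=
      Order.krullDim_le_of_strictMono
        (PrimeSpectrum.comap (algebraMap (MvPolynomial (Fin s) k) A))
        fun _ _ h ↦ Ideal.IsIntegral.comap_lt_comap h
    rwa [MvPolynomial.ringKrullDim_of_isNoetherianRing, ringKrullDim_eq_zero_of_field,
      Nat.card_eq_fintype_card, Fintype.card_fin, zero_add] at this
  have : (m.under (MvPolynomial (Fin s) k)).IsMaximal := Ideal.IsMaximal.under _ m
  have h := Ideal.height_eq_height_add_of_liesOver_of_hasGoingDown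
    (m.under (MvPolynomial (Fin s) k)) m
  refine le_antisymm (Ideal.height_le_ringKrullDim_of_ne_top Ideal.IsPrime.ne_top') ?_
  rw [h, MvPolynomial.height_eq_of_isMaximal]
  refine hd.trans ?_
  norm_cast
  exact le_self_add

namespace GenericFlatness

section Nagata

open Polynomial in
/-- A nonzero polynomial over a domain becomes, after Nagata's change of variables, a polynomial in
the first variable whose leading coefficient is a nonzero constant. -/
theorem exists_algEquiv_leadingCoeff_finSuccEquiv {A : Type*} [CommRing A] [IsDomain A] {n : ℕ}
    (f : MvPolynomial (Fin (n + 1)) A) (hf : f ≠ 0) :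
    ∃ (e : MvPolynomial (Fin (n + 1)) A ≃ₐ[A] MvPolynomial (Fin (n + 1)) A) (a : A), a ≠ 0 ∧
      (MvPolynomial.finSuccEquiv A n (e f)).leadingCoeff = MvPolynomial.C a := by
  classical
  let up := 2 + f.totalDegree
  let T1 (c : A) : MvPolynomial (Fin (n + 1)) A →ₐ[A] MvPolynomial (Fin (n + 1)) A :=
    MvPolynomial.aeval fun i ↦ if i = 0 then MvPolynomial.X 0
      else MvPolynomial.X i + c • MvPolynomial.X 0 ^ (up ^ i.1)
  have hT (c : A) : (T1 c).comp (T1 (-c)) = AlgHom.id _ _ := by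
    rw [MvPolynomial.comp_aeval, ← MvPolynomial.aeval_X_left]
    ext i v
    cases i using Fin.cases <;> simp [T1]
  let T := AlgEquiv.ofAlgHom (T1 1) (T1 (-1)) (hT 1) (by simpa using hT (-1))
  have hX0 : MvPolynomial.finSuccEquiv A n (T (.X 0)) = Polynomial.X := by
    simp [T, T1, MvPolynomial.finSuccEquiv_X_zero]
  have hXs (i : Fin n) : MvPolynomial.finSuccEquiv A n (T (.X i.succ)) =
      Polynomial.X ^ (up ^ i.succ.1) + Polynomial.C (.X i) := by
    simp [T, T1, MvPolynomial.finSuccEquiv_X_succ, MvPolynomial.finSuccEquiv_X_zero, add_comm]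
  clear_value T
  have hup (i : Fin n) : 0 < up ^ i.succ.1 := by positivity
  have hmonic (v : Fin (n + 1) →₀ ℕ) :
      (∏ i, (MvPolynomial.finSuccEquiv A n (T (.X i))) ^ v i).Monic := by
    refine monic_prod_of_monic _ _ fun i _ ↦ Monic.pow ?_ _
    cases i using Fin.cases with
    | zero => rw [hX0]; exact monic_X
    | succ i => rw [hXs]; exact monic_X_pow_add_C _ (hup i).ne'
  have hmon (v : Fin (n + 1) →₀ ℕ) (a : A) :
      MvPolynomial.finSuccEquiv A n (T (.monomial v a)) = Polynomial.C (.C a) *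
        ∏ i, (MvPolynomial.finSuccEquiv A n (T (.X i))) ^ v i := by
    rw [MvPolynomial.monomial_eq, Finsupp.prod_fintype _ _ fun i ↦ pow_zero _]
    simp only [map_mul, map_prod, map_pow]
    congr 1
    rw [← MvPolynomial.algebraMap_eq, AlgEquiv.commutes, AlgEquiv.commutes,
      Polynomial.algebraMap_apply, MvPolynomial.algebraMap_eq]
  have hlead (v : Fin (n + 1) →₀ ℕ) (a : A) :
      (MvPolynomial.finSuccEquiv A n (T (.monomial v a))).leadingCoeff = .C a := by
    rw [hmon, leadingCoeff_mul, (hmonic v).leadingCoeff, mul_one, leadingCoeff_C]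
  have hdeg (v : Fin (n + 1) →₀ ℕ) (a : A) (ha : a ≠ 0) :
      (MvPolynomial.finSuccEquiv A n (T (.monomial v a))).natDegree =
        ∑ i : Fin (n + 1), up ^ i.1 * v i := by
    rw [hmon, natDegree_C_mul (by simpa using ha), natDegree_prod_of_monic]
    · refine Finset.sum_congr rfl fun i _ ↦ ?_
      rw [natDegree_pow, mul_comm]
      congr 1
      cases i using Fin.cases with
      | zero => rw [hX0]; simp
      | succ i => rw [hXs, natDegree_X_pow_add_C]
    · intro i _
      refine Monic.pow ?_ _
      cases i using Fin.cases with
      | zero => rw [hX0]; exact monic_X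
      | succ i => rw [hXs]; exact monic_X_pow_add_C _ (hup i).ne'
  have hinj (v w : Fin (n + 1) →₀ ℕ) (hv : v ∈ f.support) (hw : w ∈ f.support) (ne : v ≠ w) :
      ∑ x : Fin (n + 1), up ^ x.1 * v x ≠ ∑ x : Fin (n + 1), up ^ x.1 * w x := by
    have hlt (v) (hv : v ∈ f.support) : ∀ l ∈ List.ofFn v, l < up := by
      have this (i : Fin (n + 1)) : v i ≤ f.totalDegree :=
        (MvPolynomial.monomial_le_degreeOf i hv).trans (MvPolynomial.degreeOf_le_totalDegree f i)
      intro l hl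
      obtain ⟨i, rfl⟩ := List.mem_ofFn.mp hl
      exact Nat.lt_of_le_of_lt (this i) (by omega)
    intro h
    refine ne <| Finsupp.ext <| congrFun <| List.ofFn_inj.mp ?_
    apply Nat.ofDigits_inj_of_len_eq (Nat.lt_add_right f.totalDegree one_lt_two)
      (by simp) (hlt v hv) (hlt w hw)
    simpa only [Nat.ofDigits_eq_sum_mapIdx, List.mapIdx_eq_ofFn, List.get_ofFn, List.length_ofFn,
      Fin.val_cast, mul_comm, List.sum_ofFn] using! h
  obtain ⟨v, vin, vs⟩ := Finset.exists_max_image f.support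
    (fun v ↦ (MvPolynomial.finSuccEquiv A n (T (.monomial v (f.coeff v)))).natDegree)
    (MvPolynomial.support_nonempty.mpr hf)
  have hne (w) (hw : w ∈ f.support) :
      MvPolynomial.finSuccEquiv A n (T (.monomial w (f.coeff w))) ≠ 0 := by
    simpa using MvPolynomial.mem_support_iff.mp hw
  refine ⟨T, f.coeff v, MvPolynomial.mem_support_iff.mp vin, ?_⟩
  conv_lhs => rw [← f.support_sum_monomial_coeff, ← Finset.sum_erase_add _ _ vin]
  simp only [map_add, map_sum]
  rw [leadingCoeff_add_of_degree_lt, hlead]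
  refine (degree_sum_le _ _).trans_lt ?_
  refine (Finset.sup_lt_iff <| Ne.bot_lt fun x ↦ hne v vin <| degree_eq_bot.mp x).mpr
    fun w hw ↦ ?_
  obtain ⟨hwv, hw⟩ := Finset.mem_erase.mp hw
  refine degree_lt_degree (lt_of_le_of_ne (vs w hw) ?_)
  rw [hdeg _ _ (MvPolynomial.mem_support_iff.mp hw), hdeg _ _ (MvPolynomial.mem_support_iff.mp vin)]
  exact hinj w v hw vin hwv

end Nagata

end GenericFlatness

section

open TensorProduct

/-- The `A`-module `M` is flat away from the zero locus of `a`: the obstruction to injectivity of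
`M ⊗ I → M` is `a`-power torsion for all ideals `I`. -/
def Module.FlatAway {A : Type*} [CommRing A] (a : A) (M : Type*) [AddCommGroup M] [Module A M] :
    Prop :=
  ∀ (I : Ideal A) (x : M ⊗[A] I), I.subtype.lTensor M x = 0 → ∃ n : ℕ, a ^ n • x = 0

namespace Module.FlatAway

variable {A : Type*} [CommRing A] {a b : A} {M N P : Type*} [AddCommGroup M] [Module A M]
  [AddCommGroup N] [Module A N] [AddCommGroup P] [Module A P]

theorem mul_left (h : FlatAway a M) (b : A) : FlatAway (b * a) M := fun I x hx ↦ by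
  obtain ⟨n, hn⟩ := h I x hx
  exact ⟨n, by rw [mul_pow, mul_smul, hn, smul_zero]⟩

theorem mul_right (h : FlatAway a M) (b : A) : FlatAway (a * b) M := by
  rw [mul_comm]; exact h.mul_left b

theorem of_flat [Module.Flat A M] : FlatAway a M := fun I x hx ↦ ⟨0, by
  have := Module.Flat.lTensor_preserves_injective_linearMap (M := M) I.subtype I.subtype_injective
  rw [pow_zero, one_smul]
  exact this (by rw [hx, map_zero])⟩

theorem of_torsion (h : ∀ m : M, ∃ n : ℕ, a ^ n • m = 0) : FlatAway a M := fun I x h0 ↦ by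
  clear h0
  induction x with
  | zero => exact ⟨0, smul_zero _⟩
  | tmul m i =>
    obtain ⟨n, hn⟩ := h m
    exact ⟨n, by rw [TensorProduct.smul_tmul', hn, TensorProduct.zero_tmul]⟩
  | add x y hx hy =>
    obtain ⟨m, hm⟩ := hx
    obtain ⟨n, hn⟩ := hy
    refine ⟨m + n, ?_⟩
    rw [smul_add, pow_add, mul_smul _ _ y, hn, smul_zero, add_zero, mul_comm, mul_smul, hm,
      smul_zero]

theorem of_exact {f : M →ₗ[A] N} {g : N →ₗ[A] P} (hf : Function.Injective f)
    (hg : Function.Surjective g) (hfg : Function.Exact f g) (hM : FlatAway a M)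
    (hP : FlatAway a P) : FlatAway a N := fun I x hx ↦ by
  obtain ⟨n, hn⟩ := hP I (g.rTensor I x) (by
    rw [← LinearMap.comp_apply, LinearMap.lTensor_comp_rTensor, ← LinearMap.rTensor_comp_lTensor,
      LinearMap.comp_apply, hx, map_zero])
  obtain ⟨y, hy⟩ := (rTensor_exact I hfg hg (a ^ n • x)).mp (by rw [map_smul, hn])
  have hy0 : I.subtype.lTensor M y = 0 := by
    apply (Module.Flat.rTensor_preserves_injective_linearMap (M := A) f hf)
    rw [map_zero, ← LinearMap.comp_apply, LinearMap.rTensor_comp_lTensor,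
      ← LinearMap.lTensor_comp_rTensor, LinearMap.comp_apply, hy, map_smul, hx, smul_zero]
  obtain ⟨m, hm⟩ := hM I y hy0
  exact ⟨m + n, by rw [pow_add, mul_smul, ← hy, ← map_smul, hm, map_zero]⟩

theorem of_equiv (e : M ≃ₗ[A] N) (h : FlatAway a M) : FlatAway a N := fun I x hx ↦ by
  obtain ⟨n, hn⟩ := h I (e.symm.toLinearMap.rTensor I x) (by
    rw [← LinearMap.comp_apply, LinearMap.lTensor_comp_rTensor, ← LinearMap.rTensor_comp_lTensor,
      LinearMap.comp_apply, hx, map_zero])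
  refine ⟨n, ?_⟩
  have := congr(e.toLinearMap.rTensor I $hn)
  rw [map_smul, ← LinearMap.comp_apply, ← LinearMap.rTensor_comp] at this
  simpa using this

open AlgebraTensorModule in
/-- A localization of `M` on which `a` is invertible is flat. -/
theorem flat_isLocalizedModule {B : Type*} [CommRing B] [Algebra A B] [Module B M]
    [IsScalarTower A B M] [Module B N] [IsScalarTower A B N] (h : FlatAway a M) (S : Submonoid B)
    (ha : algebraMap A B a ∈ S) (f : M →ₗ[B] N) [IsLocalizedModule S f] : Module.Flat A N := by
  rw [Module.Flat.iff_lTensor_injective']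
  intro I
  rw [injective_iff_map_eq_zero]
  intro x hx
  obtain ⟨⟨y, s⟩, hy⟩ := IsLocalizedModule.surj S (rTensor A I f) x
  have hc : rTensor A A f (I.subtype.lTensor M y) = I.subtype.lTensor N (rTensor A I f y) :=
    congr($((LinearMap.rTensor_comp_lTensor _ (f.restrictScalars A) I.subtype).trans
      (LinearMap.lTensor_comp_rTensor _ (f.restrictScalars A) I.subtype).symm) y)
  have hs (s : B) (x : N ⊗[A] I) : I.subtype.lTensor N (s • x) = s • I.subtype.lTensor N x :=
    map_smul (lTensor B N I.subtype) s x
  have hs' (s : B) (x : M ⊗[A] I) : I.subtype.lTensor M (s • x) = s • I.subtype.lTensor M x :=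
    map_smul (lTensor B M I.subtype) s x
  have h1 : rTensor A A f (I.subtype.lTensor M y) = 0 := by
    rw [hc, ← hy, Submonoid.smul_def, hs, hx, smul_zero]
  obtain ⟨t, ht⟩ := (IsLocalizedModule.eq_zero_iff S (rTensor A A f)).mp h1
  obtain ⟨n, hn⟩ := h I (t • y) (by rw [Submonoid.smul_def, hs', ← Submonoid.smul_def, ht])
  have h2 : rTensor A I f y = 0 := by
    rw [IsLocalizedModule.eq_zero_iff S (rTensor A I f)]
    refine ⟨⟨algebraMap A B a ^ n, pow_mem ha n⟩ * t, ?_⟩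
    rw [mul_smul, Submonoid.smul_def]
    change algebraMap A B a ^ n • t • y = 0
    rw [← map_pow, algebraMap_smul, hn]
  rw [h2] at hy
  exact IsLocalizedModule.smul_injective (rTensor A I f) s (by simpa using hy)

end Module.FlatAway

end

open Polynomial in
theorem Polynomial.exists_leadingCoeff_pow_smul_mem_span {D R : Type*} [CommRing D] [CommRing R]
    [Algebra D R] (t : R) (ht : Function.Surjective (aeval (R := D) t)) (p : D[X])
    (hp : aeval t p = 0) (r : R) :
    ∃ n : ℕ, p.leadingCoeff ^ n • r ∈ Submodule.span D ((t ^ ·) '' Set.Iio p.natDegree) := by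
  set N := Submodule.span D ((t ^ ·) '' Set.Iio p.natDegree)
  let N' : Submodule D R :=
    { carrier := {r | ∃ n : ℕ, p.leadingCoeff ^ n • r ∈ N}
      zero_mem' := ⟨0, by simp⟩
      add_mem' := by
        rintro x y ⟨m, hm⟩ ⟨n, hn⟩
        refine ⟨m + n, ?_⟩
        rw [smul_add]
        refine add_mem ?_ ?_
        · rw [pow_add, mul_comm, mul_smul]; exact N.smul_mem _ hm
        · rw [pow_add, mul_smul]; exact N.smul_mem _ hn
      smul_mem' := by
        rintro d x ⟨n, hn⟩
        exact ⟨n, by rw [smul_comm]; exact N.smul_mem _ hn⟩ }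
  have hpow (j : ℕ) : t ^ j ∈ N' := by
    induction j using Nat.strong_induction_on with
    | _ j ih =>
      by_cases hj : j < p.natDegree
      · exact ⟨0, by rw [pow_zero, one_smul]; exact Submodule.subset_span ⟨j, hj, rfl⟩⟩
      · push Not at hj
        obtain ⟨j, rfl⟩ := Nat.exists_eq_add_of_le hj
        have h1 : p.leadingCoeff • t ^ (p.natDegree + j) ∈ N' := by
          rw [aeval_eq_sum_range, Finset.sum_range_succ] at hp
          have := congr($hp * t ^ j)
          rw [add_mul, zero_mul, Finset.sum_mul, smul_mul_assoc, ← pow_add, add_comm,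
            coeff_natDegree] at this
          rw [eq_neg_of_add_eq_zero_left this]
          refine neg_mem (sum_mem fun i hi ↦ ?_)
          rw [smul_mul_assoc, ← pow_add]
          exact N'.smul_mem _ (ih _ (by have := Finset.mem_range.mp hi; omega))
        obtain ⟨n, hn⟩ := h1
        exact ⟨n + 1, by rwa [pow_succ, mul_smul]⟩
  obtain ⟨q, rfl⟩ := ht r
  change _ ∈ N'
  rw [aeval_eq_sum_range]
  exact sum_mem fun i _ ↦ N'.smul_mem _ (hpow i)

namespace Module.FlatAway

universe u

theorem exists_of_finite {A C : Type u} [CommRing A] [IsDomain A] [CommRing C]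
    [IsNoetherianRing C] [Algebra A C] [Module.Flat A C]
    (H : ∀ p : Ideal C, p.IsPrime → p ≠ ⊥ → ∃ a : A, a ≠ 0 ∧ FlatAway a (C ⧸ p))
    (M : Type u) [AddCommGroup M] [Module A M] [Module C M]
    [IsScalarTower A C M] [Module.Finite C M] :
    ∃ a : A, a ≠ 0 ∧ FlatAway a M := by
  refine IsNoetherianRing.induction_on_isQuotientEquivQuotientPrime C (M := M) inferInstance
    (motive := fun N _ _ _ ↦ ∀ [Module A N] [IsScalarTower A C N],
      ∃ a : A, a ≠ 0 ∧ FlatAway a N) ?_ ?_ ?_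
  · intro N _ _ _ _ _ _
    exact ⟨1, one_ne_zero, .of_flat⟩
  · intro N _ _ _ p f _ _
    by_cases hp : p.1 = ⊥
    · have : Module.Flat A (C ⧸ p.1) :=
        .of_linearEquiv ((Submodule.quotEquivOfEqBot _ hp).restrictScalars A)
      have : Module.Flat A N := .of_linearEquiv (f.restrictScalars A)
      exact ⟨1, one_ne_zero, .of_flat⟩
    · obtain ⟨a, ha, h⟩ := H p.1 p.2 hp
      exact ⟨a, ha, h.of_equiv (f.symm.restrictScalars A)⟩
  · intro N₁ _ _ _ N₂ _ _ _ N₃ _ _ _ f g hf hg hfg h₁ h₃ _ _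
    let : Module A N₁ := .compHom _ (algebraMap A C)
    let : Module A N₃ := .compHom _ (algebraMap A C)
    have : IsScalarTower A C N₁ := .of_algebraMap_smul fun _ _ ↦ rfl
    have : IsScalarTower A C N₃ := .of_algebraMap_smul fun _ _ ↦ rfl
    obtain ⟨a, ha, h₁⟩ := h₁
    obtain ⟨b, hb, h₃⟩ := h₃
    exact ⟨a * b, mul_ne_zero ha hb, .of_exact (f := f.restrictScalars A)
      (g := g.restrictScalars A) hf hg hfg (h₁.mul_right b) (h₃.mul_left a)⟩

open Polynomial in
theorem exists_of_leadingCoeff {A D R : Type u} [CommRing A] [IsDomain A] [CommRing D]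
    [CommRing R] [Algebra A D] [Algebra A R] (φ : D[X] →ₐ[A] R) (hφ : Function.Surjective φ)
    (P : D[X]) (hφF : φ P = 0) {a : A} (ha : a ≠ 0) (hlead : P.leadingCoeff = algebraMap A D a)
    (ih : ∀ (N : Type u) [AddCommGroup N] [Module A N] [Module D N] [IsScalarTower A D N]
      [Module.Finite D N], ∃ a : A, a ≠ 0 ∧ FlatAway a N) :
    ∃ a : A, a ≠ 0 ∧ FlatAway a R := by
  let : Algebra D R :=
    (φ.toRingHom.comp Polynomial.C).toAlgebra
  have : IsScalarTower A D R :=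
    .of_algebraMap_eq fun x ↦ (φ.commutes x).symm
  have haeval : (Polynomial.aeval (R := D) (φ Polynomial.X)).toRingHom =
      φ.toRingHom := by
    refine Polynomial.ringHom_ext (fun x ↦ ?_) ?_
    · exact Polynomial.aeval_C _ _
    · exact Polynomial.aeval_X _
  have haeval' (x) : Polynomial.aeval (R := D) (φ Polynomial.X) x = φ x :=
    congr($haeval x)
  have key := Polynomial.exists_leadingCoeff_pow_smul_mem_span
    (R := R) (φ Polynomial.X)
    (fun y ↦ by obtain ⟨x, rfl⟩ := hφ y; exact ⟨x, haeval' x⟩) P (by rw [haeval', hφF])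
  set N := Submodule.span D
    ((φ Polynomial.X ^ ·) '' Set.Iio P.natDegree) with hN
  have : Module.Finite D N :=
    Module.Finite.span_of_finite _ ((Set.finite_Iio _).image _)
  obtain ⟨b, hb, h⟩ := ih N
  refine ⟨a * b, mul_ne_zero ha hb, .of_exact (f := (N.restrictScalars A).subtype)
    (g := (N.restrictScalars A).mkQ) (Submodule.subtype_injective _)
    (Submodule.mkQ_surjective _) (LinearMap.exact_subtype_mkQ _) (h.mul_left a)
    (.mul_right (.of_torsion fun m ↦ ?_) b)⟩
  obtain ⟨r, rfl⟩ := Submodule.mkQ_surjective _ m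
  obtain ⟨n, hn⟩ := key r
  refine ⟨n, ?_⟩
  rw [← map_smul, Submodule.mkQ_apply, Submodule.Quotient.mk_eq_zero]
  rw [hlead, ← map_pow, algebraMap_smul] at hn
  exact hn

theorem exists_of_finite_mvPolynomial (A : Type u) [CommRing A] [IsDomain A] [IsNoetherianRing A]
    (n : ℕ) (M : Type u) [AddCommGroup M] [Module A M] [Module (MvPolynomial (Fin n) A) M]
    [IsScalarTower A (MvPolynomial (Fin n) A) M] [Module.Finite (MvPolynomial (Fin n) A) M] :
    ∃ a : A, a ≠ 0 ∧ FlatAway a M := by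
  induction n generalizing M with
  | zero =>
    refine exists_of_finite (C := MvPolynomial (Fin 0) A) (fun p _ hp ↦ ?_) M
    obtain ⟨F, hF, hF0⟩ := Submodule.exists_mem_ne_zero_of_ne_bot hp
    obtain ⟨a, rfl⟩ := MvPolynomial.C_surjective (Fin 0) F
    refine ⟨a, by simpa using hF0, .of_torsion fun m ↦ ⟨1, ?_⟩⟩
    obtain ⟨m, rfl⟩ := Ideal.Quotient.mk_surjective m
    rw [pow_one, ← Ideal.Quotient.mkₐ_eq_mk A, ← map_smul, Ideal.Quotient.mkₐ_eq_mk,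
      Ideal.Quotient.eq_zero_iff_mem, MvPolynomial.smul_eq_C_mul]
    exact p.mul_mem_right _ hF
  | succ n ih =>
    refine exists_of_finite (C := MvPolynomial (Fin (n + 1)) A) (fun p _ hp ↦ ?_) M
    obtain ⟨F, hF, hF0⟩ := Submodule.exists_mem_ne_zero_of_ne_bot hp
    obtain ⟨e, a, ha, hlead⟩ := GenericFlatness.exists_algEquiv_leadingCoeff_finSuccEquiv F hF0
    let φ : Polynomial (MvPolynomial (Fin n) A) →ₐ[A] MvPolynomial (Fin (n + 1)) A ⧸ p :=
      (Ideal.Quotient.mkₐ A p).comp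
        ((e.symm.toAlgHom).comp (MvPolynomial.finSuccEquiv A n).symm.toAlgHom)
    have hφ : Function.Surjective φ :=
      (Ideal.Quotient.mk_surjective).comp (e.symm.surjective.comp
        (MvPolynomial.finSuccEquiv A n).symm.surjective)
    have hφF : φ (MvPolynomial.finSuccEquiv A n (e F)) = 0 := by
      simpa [φ] using Ideal.Quotient.eq_zero_iff_mem.mpr hF
    exact exists_of_leadingCoeff φ hφ _ hφF ha (by rw [hlead, MvPolynomial.algebraMap_eq])
      fun N _ _ _ _ _ ↦ ih N

/-- Generic flatness. -/
theorem exists_of_finiteType (A B : Type u) [CommRing A] [IsDomain A] [IsNoetherianRing A]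
    [CommRing B] [Algebra A B] [Algebra.FiniteType A B] : ∃ a : A, a ≠ 0 ∧ FlatAway a B := by
  obtain ⟨n, f, hf⟩ := Algebra.FiniteType.iff_quotient_mvPolynomial''.mp ‹Algebra.FiniteType A B›
  let := f.toAlgebra
  have : IsScalarTower A (MvPolynomial (Fin n) A) B :=
    .of_algebraMap_eq fun x ↦ (f.commutes x).symm
  have : Module.Finite (MvPolynomial (Fin n) A) B :=
    .of_surjective (Algebra.linearMap (MvPolynomial (Fin n) A) B) hf
  exact exists_of_finite_mvPolynomial A n B

end Module.FlatAway

theorem Module.FlatAway.flat_localRingHom {A B : Type*} [CommRing A] [CommRing B] {φ : A →+* B}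
    {a : A} (h : letI := φ.toAlgebra; FlatAway a B) (p : Ideal A) [p.IsPrime] (q : Ideal B)
    [q.IsPrime] (hpq : p = q.comap φ) (ha : a ∉ p) :
    (Localization.localRingHom p q φ hpq).Flat := by
  subst hpq
  algebraize [φ, Localization.localRingHom (Ideal.comap φ q) q φ rfl]
  have : IsScalarTower A (Localization.AtPrime (Ideal.comap φ q)) (Localization.AtPrime q) :=
    .of_algebraMap_eq fun x ↦ (Localization.localRingHom_to_map _ _ _ rfl x).symm
  rw [RingHom.Flat, Module.flat_iff_of_isLocalization (S := Localization.AtPrime (Ideal.comap φ q))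
    (p := (Ideal.comap φ q).primeCompl)]
  exact flat_isLocalizedModule h q.primeCompl ha (Algebra.linearMap B (Localization.AtPrime q))

namespace AlgebraicGeometry

/-- Flatness of a morphism over an open subset can be checked on stalks. -/
theorem Flat.morphismRestrict_of_stalkMap {W B : Scheme.{0}} (f : W ⟶ B) (V : B.Opens)
    (H : ∀ x, f x ∈ V → (f.stalkMap x).hom.Flat) : Flat (f ∣_ V) := by
  refine Flat.of_stalkMap _ fun x ↦ ?_
  have := RingHom.toMorphismProperty_respectsIso_iff.mp RingHom.Flat.respectsIso
  exact ((RingHom.toMorphismProperty RingHom.Flat).arrow_mk_iso_iff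
    (morphismRestrictStalkMap f V x)).mpr (H x.1 x.2)

theorem IsAffineOpen.mem_basicOpen_iff_notMem_primeIdealOf {X : Scheme.{0}} {U : X.Opens}
    (hU : IsAffineOpen U) (a : Γ(X, U)) (x : U) :
    x.1 ∈ X.basicOpen a ↔ a ∉ (hU.primeIdealOf x).asIdeal := by
  conv_lhs => rw [← hU.fromSpec_primeIdealOf x]
  have := hU.fromSpec_preimage_basicOpen a
  exact (SetLike.ext_iff.mp this (hU.primeIdealOf x))

/-- Generic flatness for morphisms of finite type to an integral locally Noetherian scheme. -/
theorem Flat.exists_morphismRestrict {W B : Scheme.{0}} (f : W ⟶ B) [LocallyOfFiniteType f]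
    [QuasiCompact f] [IsIntegral B] [IsLocallyNoetherian B] :
    ∃ V : B.Opens, (V : Set B).Nonempty ∧ Flat (f ∣_ V) := by
  obtain ⟨_, ⟨V₀, hA, rfl⟩, hne, -⟩ := B.isBasis_affineOpens.exists_subset_of_mem_open
    (Set.mem_univ (genericPoint B)) isOpen_univ
  replace hA : IsAffineOpen V₀ := hA
  have : Nonempty V₀ := ⟨⟨_, hne⟩⟩
  have : IsNoetherianRing Γ(B, V₀) := IsLocallyNoetherian.component_noetherian ⟨V₀, hA⟩
  have hcpt : IsCompact (f ⁻¹ᵁ V₀ : Set W) := QuasiCompact.isCompact_preimage _ V₀.2 hA.isCompact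
  obtain ⟨s, hs, hsU⟩ := isCompact_iff_finite_and_eq_biUnion_affineOpens.mp hcpt
  have hle (i : s) : i.1.1 ≤ f ⁻¹ᵁ V₀ := hsU ▸ le_iSup₂_of_le i.1 i.2 le_rfl
  have key (i : s) : ∃ a : Γ(B, V₀), a ≠ 0 ∧
      letI := (f.appLE V₀ i.1.1 (hle i)).hom.toAlgebra; Module.FlatAway a Γ(W, i.1.1) := by
    algebraize [(f.appLE V₀ i.1.1 (hle i)).hom]
    have : Algebra.FiniteType Γ(B, V₀) Γ(W, i.1.1) :=
      LocallyOfFiniteType.finiteType_appLE f hA i.1.2 (hle i)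
    exact Module.FlatAway.exists_of_finiteType _ _
  choose a ha h using key
  classical
  have := hs.fintype
  refine ⟨B.basicOpen (∏ i, a i), ?_, Flat.morphismRestrict_of_stalkMap _ _ fun x hx ↦ ?_⟩
  · rw [Set.nonempty_iff_ne_empty]
    intro h0
    exact Finset.prod_ne_zero_iff.mpr (fun i _ ↦ ha i)
      ((basicOpen_eq_bot_iff _).mp (SetLike.coe_injective h0))
  · have hx' : x ∈ f ⁻¹ᵁ V₀ := B.basicOpen_le _ hx
    rw [hsU] at hx'
    simp only [Opens.mem_iSup] at hx'
    obtain ⟨i, hi, hxi⟩ := hx'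
    have hxa : f x ∈ B.basicOpen (a ⟨i, hi⟩) := by
      rw [← Finset.mul_prod_erase _ _ (Finset.mem_univ (⟨i, hi⟩ : s)),
        Scheme.basicOpen_mul] at hx
      exact hx.1
    have := RingHom.toMorphismProperty_respectsIso_iff.mp RingHom.Flat.respectsIso
    refine ((RingHom.toMorphismProperty RingHom.Flat).arrow_mk_iso_iff
      (IsAffineOpen.arrowStalkMapIso f V₀ hA i.1 i.2 (hle ⟨i, hi⟩) hxi)).mpr ?_
    refine (h ⟨i, hi⟩).flat_localRingHom _ _
      congr($(IsAffineOpen.comap_primeIdealOf_appLE V₀ hA i.1 i.2 (hle ⟨i, hi⟩) hxi).1).symm ?_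
    exact (hA.mem_basicOpen_iff_notMem_primeIdealOf _ ⟨f x, _⟩).mp hxa

end AlgebraicGeometry

section RegularLocalRing

open IsLocalRing

/-- Elements of the maximal ideal which are linearly independent in the cotangent space extend to
a minimal system of generators of the maximal ideal. -/
lemma IsLocalRing.exists_finset_span_eq_maximalIdeal {R : Type*} [CommRing R] [IsLocalRing R]
    [IsNoetherianRing R] {ι : Type*} [Fintype ι] (f : ι → maximalIdeal R)
    (hf : LinearIndependent (ResidueField R) fun i ↦ (maximalIdeal R).toCotangent (f i)) :
    ∃ t : Finset R, Ideal.span (Set.range (fun i ↦ (f i : R)) ∪ t) = maximalIdeal R ∧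
      t.card + Fintype.card ι = Module.finrank (ResidueField R) (CotangentSpace R) := by
  classical
  let b := Module.Basis.sumExtend hf
  have : Finite (ι ⊕ Module.Basis.sumExtendIndex hf) := Module.Finite.finite_basis b
  have : Finite (Module.Basis.sumExtendIndex hf) :=
    Finite.of_injective (Sum.inr (α := ι)) Sum.inr_injective
  have := Fintype.ofFinite (Module.Basis.sumExtendIndex hf)
  choose c hc using (maximalIdeal R).toCotangent_surjective
  have hb (i : ι) : b (Sum.inl i) = (maximalIdeal R).toCotangent (f i) := by
    simp [b, Module.Basis.sumExtend, Equiv.sumCongr]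
    rfl
  let g : Module.Basis.sumExtendIndex hf → maximalIdeal R := fun j ↦ c (b (Sum.inr j))
  have hg : Function.Injective fun j ↦ (g j : R) := by
    intro i j h
    have h' : g i = g j := Subtype.ext h
    have := congrArg (maximalIdeal R).toCotangent h'
    simp only [g, hc] at this
    exact Sum.inr_injective (b.injective this)
  refine ⟨Finset.univ.image fun j ↦ (g j : R), ?_, ?_⟩
  · have htop : Submodule.span R (Set.range f ∪ Set.range g) = ⊤ := by
      rw [← CotangentSpace.span_image_eq_top_iff, ← b.span_eq]
      congr 1
      ext x
      simp only [Set.image_union, Set.mem_union, Set.mem_range, Sum.exists, Set.mem_image,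
        exists_exists_eq_and, hb, g, hc]
    have := congrArg (Submodule.map (maximalIdeal R).subtype) htop
    rw [Submodule.map_span, Submodule.map_top, Submodule.range_subtype, Set.image_union,
      ← Set.range_comp, ← Set.range_comp] at this
    refine Eq.trans ?_ this
    simp only [Finset.coe_image, Finset.coe_univ, Set.image_univ]
    rfl
  · rw [Finset.card_image_of_injective _ hg, Module.finrank_eq_card_basis b, Fintype.card_sum,
      add_comm, Finset.card_univ]

lemma IsRegularLocalRing.finrank_cotangentSpace (R : Type*) [CommRing R] [IsRegularLocalRing R] :
    Module.finrank (ResidueField R) (CotangentSpace R) = ringKrullDim R :=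
  (IsRegularLocalRing.iff_finrank_cotangentSpace R).mp inferInstance

/-- A quotient of a regular local ring by part of a regular system of parameters is regular. -/
lemma IsRegularLocalRing.quotient_span_range {R : Type*} [CommRing R] [IsRegularLocalRing R]
    {ι : Type*} [Fintype ι] (f : ι → maximalIdeal R)
    (hf : LinearIndependent (ResidueField R) fun i ↦ (maximalIdeal R).toCotangent (f i)) :
    IsRegularLocalRing (R ⧸ Ideal.span (Set.range fun i ↦ (f i : R))) ∧
      ringKrullDim (R ⧸ Ideal.span (Set.range fun i ↦ (f i : R))) + Fintype.card ι =
        ringKrullDim R := by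
  classical
  obtain ⟨t, ht, hcard⟩ := exists_finset_span_eq_maximalIdeal f hf
  set I := Ideal.span (Set.range fun i ↦ (f i : R)) with hI
  have hIm : I ≤ maximalIdeal R := by
    rw [hI, Ideal.span_le]
    rintro _ ⟨i, rfl⟩
    exact (f i).2
  have : Nontrivial (R ⧸ I) := Ideal.Quotient.nontrivial_iff.mpr
    (fun h ↦ (maximalIdeal.isMaximal R).ne_top (top_le_iff.mp (h ▸ hIm)))
  have : IsLocalRing (R ⧸ I) := .of_surjective' _ Ideal.Quotient.mk_surjective
  have hmax : maximalIdeal (R ⧸ I) = Ideal.span (t.image (Ideal.Quotient.mk I) : Set (R ⧸ I)) := by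
    have h1 : (maximalIdeal R).map (Ideal.Quotient.mk I) = maximalIdeal (R ⧸ I) :=
      have hloc : IsLocalHom (Ideal.Quotient.mk I) := .of_surjective _ Ideal.Quotient.mk_surjective
      ((local_hom_TFAE (Ideal.Quotient.mk I)).out 0 4 |>.mp hloc) ▸
        Ideal.map_comap_of_surjective _ Ideal.Quotient.mk_surjective _
    rw [← h1, ← ht, Ideal.map_span, Set.image_union, Ideal.span_union, ← Ideal.map_span,
      Ideal.map_quotient_self, bot_sup_eq, Finset.coe_image]
  have hle : (maximalIdeal (R ⧸ I)).spanFinrank ≤ t.card := by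
    rw [hmax]
    refine (Submodule.spanFinrank_span_le_ncard_of_finite (Finset.finite_toSet _)).trans ?_
    rw [Set.ncard_coe_finset]
    exact Finset.card_image_le
  have hdim : ringKrullDim R ≤ ringKrullDim (R ⧸ I) + Fintype.card ι := by
    have := ringKrullDim_le_ringKrullDim_quotient_add_card
      (Finset.univ.image fun i ↦ (f i : R)) (by
        rw [IsLocalRing.ringJacobson_eq_maximalIdeal]
        intro x hx
        simp only [Finset.coe_image, Finset.coe_univ, Set.image_univ] at hx
        obtain ⟨i, rfl⟩ := hx
        exact (f i).2)
    rw [Finset.coe_image, Finset.coe_univ, Set.image_univ] at this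
    refine this.trans ?_
    gcongr
    exact_mod_cast Finset.card_image_le
  have hR := IsRegularLocalRing.finrank_cotangentSpace R
  have hup : ringKrullDim (R ⧸ I) ≤ t.card :=
    (ringKrullDim_le_spanFinrank_maximalIdeal _).trans (by exact_mod_cast hle)
  rw [← hR, ← hcard] at hdim ⊢
  have hlow : (t.card : WithBot ℕ∞) ≤ ringKrullDim (R ⧸ I) := by
    generalize ringKrullDim (R ⧸ I) = d at *
    induction d with
    | bot => simp at hdim
    | coe d =>
      norm_cast at *
      induction d with
      | top => simp
      | coe d => norm_cast at *; lia
  have heq := le_antisymm hup hlow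
  refine ⟨.of_spanFinrank_maximalIdeal_le _ ?_, by rw [heq]; push_cast; rfl⟩
  rw [heq]
  exact_mod_cast hle

/-- Regular local rings are domains. -/
theorem IsRegularLocalRing.isDomain (R : Type*) [CommRing R] [IsRegularLocalRing R] :
    IsDomain R := by
  obtain ⟨n, hn⟩ : ∃ n : ℕ, ringKrullDim R = n := ⟨_, (finrank_cotangentSpace R).symm⟩
  induction n generalizing R with
  | zero =>
    have h := finrank_cotangentSpace R
    rw [hn] at h
    have : IsField R := finrank_cotangentSpace_eq_zero_iff.mp (by exact_mod_cast h)
    exact this.isDomain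
  | succ n ih =>
    have hfin := minimalPrimes.finite_of_isNoetherianRing R
    obtain ⟨x, hxm, hx⟩ : ∃ x ∈ maximalIdeal R,
        x ∉ ⋃ I ∈ insert ((maximalIdeal R) ^ 2) (minimalPrimes R), (I : Set R) := by
      by_contra! H
      obtain ⟨I, hI, hle⟩ := (Ideal.subset_union_prime_finite (hfin.insert _) (f := id)
        ((maximalIdeal R) ^ 2) ((maximalIdeal R) ^ 2)
        (by rintro I (rfl | hI) h; exacts [(h rfl).elim, fun _ ↦ hI.1.1])).mp (fun x hx ↦ H x hx)
      have hpos : (maximalIdeal R).height ≠ 0 := by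
        intro h
        have := maximalIdeal_height_eq_ringKrullDim (R := R)
        rw [h, hn] at this
        norm_cast at this
      obtain rfl | hI := hI
      · have h1 : IsIdempotentElem (maximalIdeal R) := by
          rw [IsIdempotentElem, ← pow_two]
          exact le_antisymm (Ideal.pow_le_self two_ne_zero) hle
        have := subsingleton_cotangentSpace_iff.mp
          ((Ideal.cotangent_subsingleton_iff _).mpr h1)
        rw [IsLocalRing.isField_iff_maximalIdeal_eq] at this
        rw [this] at hpos
        have hp : (⊥ : Ideal R).IsPrime := this ▸ inferInstance
        exact hpos (by simp [Ideal.height_bot])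
      · have : maximalIdeal R = I := le_antisymm hle
          (IsLocalRing.le_maximalIdeal hI.1.1.ne_top)
        exact hpos (by rwa [Ideal.height_eq_zero_iff, this])
    simp only [Set.mem_iUnion, Set.mem_insert_iff, SetLike.mem_coe, exists_prop, exists_eq_or_imp,
      not_or, not_exists, not_and] at hx
    have hlin : LinearIndependent (ResidueField R)
        fun i : Unit ↦ (maximalIdeal R).toCotangent ((fun _ ↦ ⟨x, hxm⟩) i) := by
      rw [linearIndependent_unique_iff]
      exact fun h ↦ hx.1 ((Ideal.toCotangent_eq_zero _ _).mp h)
    obtain ⟨hreg, hdim⟩ := quotient_span_range _ hlin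
    have hrange : (Set.range fun i : Unit ↦ (((fun _ ↦ ⟨x, hxm⟩) i : maximalIdeal R) : R)) = {x} :=
      Set.range_const
    rw [hrange] at hreg hdim
    rw [Fintype.card_unit, hn] at hdim
    have hdom : IsDomain (R ⧸ Ideal.span {x}) := by
      refine ih _ ?_
      rw [← finrank_cotangentSpace] at hdim ⊢
      norm_cast at *
      lia
    have hprime : (Ideal.span {x}).IsPrime := (Ideal.Quotient.isDomain_iff_prime _).mp hdom
    obtain ⟨p, hp, hpx⟩ := Ideal.exists_minimalPrimes_le (bot_le (a := Ideal.span {x}))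
    have hpp : p.IsPrime := hp.1.1
    have hxp : x ∉ p := hx.2 p hp
    have hpeq : p ≤ Ideal.span {x} * p := by
      intro y hy
      obtain ⟨z, rfl⟩ := Ideal.mem_span_singleton'.mp (hpx hy)
      rw [mul_comm z x]
      refine Ideal.mul_mem_mul (Ideal.mem_span_singleton_self x) ?_
      exact (hpp.mem_or_mem hy).resolve_right hxp
    have : p = ⊥ := by
      refine Submodule.eq_bot_of_le_smul_of_le_jacobson_bot (Ideal.span {x}) p
        (IsNoetherian.noetherian _) hpeq ?_
      rw [IsLocalRing.jacobson_eq_maximalIdeal _ bot_ne_top]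
      exact (Ideal.span_singleton_le_iff_mem _).mpr hxm
    subst this
    exact IsDomain.of_bot_isPrime R

end RegularLocalRing

section RegularLocalRing

open IsLocalRing TensorProduct

/-- The kernel of a surjection between regular local rings is generated by part of a regular system
of parameters. -/
lemma IsRegularLocalRing.exists_ker_eq_span_range {P A : Type*} [CommRing P] [CommRing A]
    [IsRegularLocalRing P] [IsRegularLocalRing A] (φ : P →+* A) (hφ : Function.Surjective φ) :
    ∃ (r : ℕ) (f : Fin r → maximalIdeal P),
      LinearIndependent (ResidueField P) (fun i ↦ (maximalIdeal P).toCotangent (f i)) ∧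
      RingHom.ker φ = Ideal.span (Set.range fun i ↦ (f i : P)) := by
  classical
  have hloc : IsLocalHom φ := .of_surjective _ hφ
  have hker : RingHom.ker φ ≤ maximalIdeal P :=
    IsLocalRing.le_maximalIdeal (RingHom.ker_ne_top φ)
  let s : Set (maximalIdeal P) := {x | (x : P) ∈ RingHom.ker φ}
  obtain ⟨b, hbs, hspan, hlin⟩ :=
    exists_linearIndependent (ResidueField P) ((maximalIdeal P).toCotangent '' s)
  have : Finite b := hlin.finite
  have := Fintype.ofFinite b
  have hf₀ (i : b) : ∃ x : maximalIdeal P, (x : P) ∈ RingHom.ker φ ∧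
      (maximalIdeal P).toCotangent x = i := hbs i.2
  choose f₀ hf₀ hf₀' using hf₀
  let eb := Fintype.equivFin b
  let f := f₀ ∘ eb.symm
  have hf : LinearIndependent (ResidueField P) (fun i ↦ (maximalIdeal P).toCotangent (f i)) := by
    have : (fun i ↦ (maximalIdeal P).toCotangent (f i)) = (fun i : b ↦ (i : CotangentSpace P)) ∘ eb.symm := by
      ext i
      exact hf₀' _
    rw [this]
    exact hlin.comp _ eb.symm.injective
  refine ⟨_, f, hf, ?_⟩
  have hle : Ideal.span (Set.range fun i ↦ (f i : P)) ≤ RingHom.ker φ := by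
    rw [Ideal.span_le]
    rintro _ ⟨i, rfl⟩
    exact hf₀ _
  obtain ⟨hreg, hdim⟩ := quotient_span_range f hf
  obtain ⟨t, ht, htcard⟩ := exists_finset_span_eq_maximalIdeal (R := A) (ι := Empty)
    (fun i ↦ i.elim) (linearIndependent_empty_type)
  have hs : Ideal.span (t : Set A) = maximalIdeal A := by
    rwa [Set.range_eq_empty, Set.empty_union] at ht
  have hg (y : t) : ∃ x : maximalIdeal P, φ x = y := by
    obtain ⟨x, hx⟩ := hφ y
    refine ⟨⟨x, ?_⟩, hx⟩
    have : (y : A) ∈ maximalIdeal A := hs ▸ Ideal.subset_span y.2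
    rw [← hx] at this
    simpa using this
  choose g hg using hg
  have htop : Submodule.span P (Set.range g ∪ s) = ⊤ := by
    rw [eq_top_iff]
    rintro ⟨x, hx⟩ -
    have hx' : φ x ∈ Ideal.span (t : Set A) := by
      rw [hs]
      simpa using hx
    have hmap : (Ideal.span (Set.range fun i ↦ (g i : P))).map φ = Ideal.span (t : Set A) := by
      rw [Ideal.map_span]
      congr 1
      ext y
      simp [hg]
    rw [← hmap, Ideal.mem_map_iff_of_surjective _ hφ] at hx'
    obtain ⟨z, hz, hzx⟩ := hx'
    have hzm : z ∈ maximalIdeal P := by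
      refine (Ideal.span_le.mpr ?_) hz
      rintro _ ⟨i, rfl⟩
      exact (g i).2
    have h1 : (⟨x, hx⟩ : maximalIdeal P) = ⟨z, hzm⟩ + (⟨x - z, sub_mem hx hzm⟩ : maximalIdeal P) := by
      ext; simp
    rw [h1]
    refine add_mem (Submodule.span_mono Set.subset_union_left ?_)
      (Submodule.subset_span (Or.inr ?_))
    · have h2 : z ∈ (Submodule.span P (Set.range g)).map (maximalIdeal P).subtype := by
        rw [Submodule.map_span, ← Set.range_comp]
        exact hz
      obtain ⟨w, hw, rfl⟩ := h2
      exact hw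
    · change x - z ∈ RingHom.ker φ
      rw [RingHom.mem_ker, map_sub, hzx, sub_self]
  have hle' : Module.finrank (ResidueField P) (CotangentSpace P) ≤ t.card + Fintype.card b := by
    rw [← finrank_top, ← CotangentSpace.span_image_eq_top_iff.mpr htop, Set.image_union,
      Submodule.span_union, ← hspan, ← Set.range_comp]
    refine (Submodule.finrank_add_le_finrank_add_finrank _ _).trans (add_le_add ?_ ?_)
    · refine (finrank_range_le_card _).trans (by simp)
    · refine (finrank_span_le_card b).trans (by simp)
  refine le_antisymm ?_ hle
  by_contra hlt
  obtain ⟨y, hy, hy'⟩ := Set.not_subset.mp hlt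
  set I := Ideal.span (Set.range fun i ↦ (f i : P))
  have hdom := IsRegularLocalRing.isDomain (P ⧸ I)
  have hne : Ideal.Quotient.mk I y ≠ 0 := fun h ↦ hy' (Ideal.Quotient.eq_zero_iff_mem.mp h)
  have h1 := ringKrullDim_quotient_succ_le_of_nonZeroDivisor (mem_nonZeroDivisors_of_ne_zero hne)
  let ψ : (P ⧸ I) ⧸ Ideal.span {Ideal.Quotient.mk I y} →+* A :=
    Ideal.Quotient.lift _ (Ideal.Quotient.lift I φ fun a ha ↦ hle ha) (by
      intro a ha
      obtain ⟨c, rfl⟩ := Ideal.mem_span_singleton'.mp ha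
      rw [map_mul]
      exact (congrArg _ (show φ y = 0 from hy)).trans (mul_zero _))
  have hψ : Function.Surjective ψ := by
    intro a
    obtain ⟨x, rfl⟩ := hφ a
    exact ⟨Ideal.Quotient.mk _ (Ideal.Quotient.mk _ x), rfl⟩
  have h2 := ringKrullDim_le_of_surjective ψ hψ
  have h3 : ringKrullDim A + 1 ≤ ringKrullDim (P ⧸ I) := le_trans (by gcongr) h1
  rw [← finrank_cotangentSpace, ← finrank_cotangentSpace] at h3 hdim
  rw [Fintype.card_fin] at hdim
  norm_cast at h3 hdim
  simp at htcard
  lia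

/-- A regular local quotient of a smooth regular local algebra is formally smooth, provided that
the residue field extension is. -/
theorem Algebra.FormallySmooth.of_isRegularLocalRing (R P A : Type*) [CommRing R] [CommRing P]
    [CommRing A] [IsRegularLocalRing P] [IsRegularLocalRing A] [Algebra R P] [Algebra R A]
    [Algebra P A] [IsScalarTower R P A] [FormallySmooth R P] [Module.Free P Ω[P⁄R]]
    [Module.Finite P Ω[P⁄R]] [FormallySmooth R (ResidueField A)]
    (h : Function.Surjective (algebraMap P A)) : FormallySmooth R A := by
  set K := ResidueField A
  have hloc : IsLocalHom (algebraMap P A) := .of_surjective _ h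
  have hK : Function.Surjective (algebraMap P K) := by
    rw [IsScalarTower.algebraMap_eq P A K]
    exact residue_surjective.comp h
  have hkerK : RingHom.ker (algebraMap P K) = maximalIdeal P :=
    eq_maximalIdeal (RingHom.ker_isMaximal_of_surjective _ hK)
  rw [iff_injective_cotangentComplexBaseChange (R := R) P K h (IsNoetherian.noetherian _)
    ker_residue.ge]
  have hinj := (iff_injective_cotangentComplexBaseChange (R := R) (S := K) P K hK
    (IsNoetherian.noetherian _) (by
      rw [(isField_iff_maximalIdeal_eq (R := K)).mp (Field.toIsField K)]
      exact bot_le)).mp inferInstance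
  have hle : RingHom.ker (algebraMap P A) ≤ RingHom.ker (algebraMap P K) := by
    rw [hkerK]
    exact IsLocalRing.le_maximalIdeal (RingHom.ker_ne_top _)
  let j : RingHom.ker (algebraMap P A) →ₗ[P] RingHom.ker (algebraMap P K) :=
    Submodule.inclusion hle
  have hcomp : (KaehlerDifferential.cotangentComplexBaseChange R A P K) =
      (KaehlerDifferential.cotangentComplexBaseChange R K P K).comp (j.baseChange K) := by
    ext x
    simp only [AlgebraTensorModule.curry_apply, LinearMap.restrictScalars_comp, curry_apply,
      LinearMap.coe_comp, LinearMap.coe_restrictScalars, Function.comp_apply,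
      LinearMap.baseChange_tmul, KaehlerDifferential.cotangentComplexBaseChange_tmul]
    rfl
  rw [hcomp, LinearMap.coe_comp]
  refine hinj.comp ?_
  obtain ⟨r, f, hf, hker⟩ := IsRegularLocalRing.exists_ker_eq_span_range (algebraMap P A) h
  rw [injective_iff_map_eq_zero]
  intro z hz
  obtain ⟨x, rfl⟩ : ∃ x, z = 1 ⊗ₜ x := by
    obtain ⟨x, hx⟩ := TensorProduct.mk_surjective P (RingHom.ker (algebraMap P A)) K hK z
    exact ⟨x, hx.symm⟩
  have hx2 : (x : P) ∈ (maximalIdeal P) ^ 2 := by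
    rw [LinearMap.baseChange_tmul] at hz
    have hex := rTensor_exact (RingHom.ker (algebraMap P K))
      (f := (RingHom.ker (algebraMap P K)).subtype) (g := Algebra.linearMap P K) (by
        intro p
        simp) hK
    obtain ⟨w, hw⟩ := (hex (1 ⊗ₜ j x)).mp (by simpa using hz)
    have : (x : P) = _root_.TensorProduct.lid P (RingHom.ker (algebraMap P K))
      ((RingHom.ker (algebraMap P K)).subtype.rTensor (RingHom.ker (algebraMap P K)) w) := by
      rw [hw]
      simp [j]
    rw [this]
    clear this hw hz
    induction w with
    | zero => simp
    | add a b ha hb =>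
      rw [map_add, map_add, Submodule.coe_add]
      exact add_mem ha hb
    | tmul a b =>
      simp only [LinearMap.rTensor_tmul, _root_.TensorProduct.lid_tmul, Submodule.subtype_apply,
        Submodule.coe_smul, smul_eq_mul]
      rw [pow_two]
      exact Ideal.mul_mem_mul (hkerK ▸ a.2) (hkerK ▸ b.2)
  have hfker (i) : (f i : P) ∈ RingHom.ker (algebraMap P A) :=
    hker ▸ Ideal.subset_span ⟨i, rfl⟩
  obtain ⟨c, hc⟩ : ∃ c : Fin r → P, ∑ i, c i * (f i : P) = x := by
    exact Ideal.mem_span_range_iff_exists_fun.mp (hker.le x.2)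
  have hcm (i) : c i ∈ maximalIdeal P := by
    have h0 : (maximalIdeal P).toCotangent (∑ i, c i • f i) = 0 := by
      rw [Ideal.toCotangent_eq_zero]
      simpa [hc] using hx2
    rw [map_sum] at h0
    have h1 : ∑ i, algebraMap P (ResidueField P) (c i) • (maximalIdeal P).toCotangent (f i) = 0 := by
      rw [← h0]
      refine Finset.sum_congr rfl fun i _ ↦ ?_
      rw [map_smul, algebraMap_smul]
    have := Fintype.linearIndependent_iff.mp hf _ h1 i
    rwa [ResidueField.algebraMap_eq, residue_eq_zero_iff] at this
  have hxs : x = ∑ i, c i • (⟨f i, hfker i⟩ : RingHom.ker (algebraMap P A)) := by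
    ext
    simp [hc]
  rw [hxs, TensorProduct.tmul_sum]
  refine Finset.sum_eq_zero fun i _ ↦ ?_
  rw [← TensorProduct.smul_tmul, Algebra.smul_def,
    (show algebraMap P K (c i) = 0 from (hkerK ▸ hcm i : c i ∈ RingHom.ker (algebraMap P K))),
    zero_mul, TensorProduct.zero_tmul]

end RegularLocalRing

section RegularLocalRing

universe u

open IsLocalRing TensorProduct

theorem Algebra.Etale.isRegularLocalRing_localization {R S : Type*} [CommRing R] [CommRing S]
    [IsRegularRing R] [Algebra R S] [Algebra.Etale R S] (q : Ideal S) [q.IsPrime] :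
    IsRegularLocalRing (Localization.AtPrime q) := by
  have : IsNoetherianRing S := Algebra.FiniteType.isNoetherianRing R S
  let p := q.under R
  let : Algebra (Localization.AtPrime p) (Localization.AtPrime q) :=
    (Localization.localRingHom p q (algebraMap R S) rfl).toAlgebra
  have : Localization.AtPrime.IsLiesOverAlgebra p q := ⟨rfl⟩
  have hmap := ((Algebra.isUnramifiedAt_iff_map_eq R p q).mp inferInstance).2
  have hmap' : (maximalIdeal (Localization.AtPrime p)).map
      (Localization.localRingHom p q (algebraMap R S) rfl) =
      maximalIdeal (Localization.AtPrime q) := by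
    rw [← Localization.AtPrime.map_eq_maximalIdeal, Ideal.map_map, ← hmap]
    congr 1
    ext x
    rw [RingHom.comp_apply, Localization.localRingHom_to_map, ← IsScalarTower.algebraMap_apply]
  refine .of_spanFinrank_maximalIdeal_le _ ?_
  have hp : IsRegularLocalRing (Localization.AtPrime p) := inferInstance
  have h1 := hp.spanFinrank_maximalIdeal
  rw [IsLocalization.AtPrime.ringKrullDim_eq_height p (Localization.AtPrime p)] at h1
  rw [IsLocalization.AtPrime.ringKrullDim_eq_height q (Localization.AtPrime q)]
  calc ((maximalIdeal (Localization.AtPrime q)).spanFinrank : WithBot ℕ∞)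
    _ ≤ (maximalIdeal (Localization.AtPrime p)).spanFinrank := by
      rw [← hmap']
      exact_mod_cast Ideal.spanFinrank_map_le_of_fg _ (IsNoetherian.noetherian _)
    _ = p.height := h1
    _ ≤ q.height := by
      rw [Ideal.height_eq_height_add_of_liesOver_of_hasGoingDown p q]
      exact_mod_cast le_self_add

theorem Algebra.IsStandardSmooth.isRegularLocalRing_localization {R S : Type*} [CommRing R]
    [CommRing S] [IsRegularRing R] [Algebra R S] [Algebra.IsStandardSmooth R S] (q : Ideal S)
    [q.IsPrime] : IsRegularLocalRing (Localization.AtPrime q) := by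
  obtain ⟨n, φ, -, hφ⟩ := RingHom.IsStandardSmooth.exists_etale_mvPolynomial
    (f := algebraMap R S) (by simpa [RingHom.isStandardSmooth_algebraMap])
  algebraize [φ]
  exact Algebra.Etale.isRegularLocalRing_localization (R := MvPolynomial (Fin n) R) q

theorem Algebra.FormallySmooth.of_isRegularLocalRing_localization (k B : Type u) [Field k]
    [PerfectField k] [CommRing B] [Algebra k B] [Algebra.FiniteType k B] (q : Ideal B) [q.IsPrime]
    [IsRegularLocalRing (Localization.AtPrime q)] :
    Algebra.FormallySmooth k (Localization.AtPrime q) := by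
  obtain ⟨n, φ, hφ⟩ := Algebra.FiniteType.iff_quotient_mvPolynomial''.mp ‹Algebra.FiniteType k B›
  let p := q.comap φ.toRingHom
  let ψ := Localization.localRingHom p q φ.toRingHom rfl
  let P := Localization.AtPrime p
  let : Algebra P (Localization.AtPrime q) := ψ.toAlgebra
  have : IsScalarTower k P (Localization.AtPrime q) := .of_algebraMap_eq fun x ↦ by
    rw [IsScalarTower.algebraMap_apply k (MvPolynomial (Fin n) k) P, RingHom.algebraMap_toAlgebra,
      Localization.localRingHom_to_map, IsScalarTower.algebraMap_apply k B]
    congr 1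
    exact (φ.commutes x).symm
  have : IsRegularLocalRing P := inferInstance
  have : Algebra.FormallySmooth (MvPolynomial (Fin n) k) P := .of_isLocalization p.primeCompl
  have : Algebra.FormallySmooth k P := .comp k (MvPolynomial (Fin n) k) P
  have : IsLocalizedModule p.primeCompl
    (KaehlerDifferential.map k k (MvPolynomial (Fin n) k) P) := inferInstance
  have : Module.Free P Ω[P⁄k] := Module.free_of_isLocalizedModule p.primeCompl
    (KaehlerDifferential.map k k (MvPolynomial (Fin n) k) P)
  have : Module.Finite P Ω[P⁄k] := Module.Finite.of_isLocalizedModule p.primeCompl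
    (KaehlerDifferential.map k k (MvPolynomial (Fin n) k) P)
  have : EssFiniteType k (ResidueField (Localization.AtPrime q)) :=
    .comp _ (Localization.AtPrime q) _
  exact .of_isRegularLocalRing k P (Localization.AtPrime q)
    (RingHom.surjective_localRingHom_of_surjective φ.toRingHom hφ q)

end RegularLocalRing

section

universe u

theorem Algebra.FormallySmooth.of_isRegularLocalRing_of_under_eq_bot {R S : Type u} [CommRing R]
    [IsDomain R] [CharZero R] [CommRing S] [Algebra R S] [Algebra.FiniteType R S] (q : Ideal S)
    [q.IsPrime] (hq : q.under R = ⊥) [IsRegularLocalRing (Localization.AtPrime q)] :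
    Algebra.FormallySmooth R (Localization.AtPrime q) := by
  let K := FractionRing R
  let M := nonZeroDivisors R
  let B := TensorProduct R K S
  have hM : Disjoint (Algebra.algebraMapSubmonoid S M : Set S) (q : Set S) := by
    rw [Set.disjoint_left]
    rintro _ ⟨r, hr, rfl⟩ h
    have : r ∈ q.under R := h
    rw [hq, Ideal.mem_bot] at this
    exact nonZeroDivisors.ne_zero hr this
  let _ : Algebra S B := Algebra.TensorProduct.rightAlgebra
  have : IsLocalization (Algebra.algebraMapSubmonoid S M) B := inferInstance
  have hprime := IsLocalization.isPrime_of_isPrime_disjoint _ B q inferInstance hM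
  let q' := q.map (algebraMap S B)
  have hcomap : q'.comap (algebraMap S B) = q :=
    IsLocalization.under_map_of_isPrime_disjoint _ B ‹q.IsPrime› hM
  have hloc : IsLocalization.AtPrime (Localization.AtPrime q') q := by
    have := IsLocalization.isLocalization_isLocalization_atPrime_isLocalization
      (Algebra.algebraMapSubmonoid S M) (Localization.AtPrime q') q'
    convert this
    exact hcomap.symm
  let e := IsLocalization.algEquiv q.primeCompl (Localization.AtPrime q) (Localization.AtPrime q')
  have : IsRegularLocalRing (Localization.AtPrime q') := .of_ringEquiv e.toRingEquiv
  have : CharZero K := inferInstance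
  have := Algebra.FormallySmooth.of_isRegularLocalRing_localization K B q'
  have : Algebra.FormallySmooth R K := .of_isLocalization M
  have : Algebra.FormallySmooth R (Localization.AtPrime q') := .comp R K _
  exact Algebra.FormallySmooth.of_equiv (A := Localization.AtPrime q') (e.symm.restrictScalars R)

end

theorem isRegularLocal_iff_isRegularLocalRing {R : Type*} [CommRing R] :
    IsRegularLocal R ↔ IsRegularLocalRing R := by
  refine ⟨fun ⟨_, _, s, hs, hcard⟩ ↦ ?_, fun h ↦ ⟨inferInstance, inferInstance, ?_⟩⟩
  · refine .of_spanFinrank_maximalIdeal_le _ (le_trans ?_ hcard.le)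
    have := Submodule.spanFinrank_span_le_ncard_of_finite (R := R) s.finite_toSet
    rw [← Ideal.span, hs, Set.ncard_coe_finset s] at this
    exact (Nat.cast_le (α := WithBot ℕ∞)).mpr this
  · obtain ⟨s, hs, hspan⟩ := IsLocalRing.exists_finset_span_eq_maximalIdeal (R := R)
      (ι := Empty) Empty.elim (linearIndependent_empty_type)
    refine ⟨s, by rwa [Set.range_eq_empty, Set.empty_union] at hs, ?_⟩
    rw [← IsRegularLocalRing.finrank_cotangentSpace, ← hspan, Fintype.card_eq_zero (α := Empty),
      add_zero]
    rfl

namespace AlgebraicGeometry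

/-- The stalk at a point of an affine open as a localization of the ring of sections. -/
noncomputable def IsAffineOpen.localizationEquivStalk {X : Scheme.{0}} {U : X.Opens}
    (hU : IsAffineOpen U) (x : U) :
    Localization.AtPrime (hU.primeIdealOf x).asIdeal ≃+* X.presheaf.stalk x.1 :=
  have := hU.isLocalization_stalk x
  (IsLocalization.algEquiv (hU.primeIdealOf x).asIdeal.primeCompl _
    (X.presheaf.stalk x.1)).toRingEquiv

theorem Smooth.isRegularLocalRing_stalk {k : Type} [Field k] {W : Scheme.{0}}
    (s : W ⟶ Spec (.of k)) [Smooth s] (x : W) : IsRegularLocalRing (W.presheaf.stalk x) := by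
  obtain ⟨U, hU, V, hV, hxV, e, h⟩ := Smooth.exists_isStandardSmooth s x
  obtain rfl : U = ⊤ := top_le_iff.mp fun y _ ↦ Subsingleton.elim (s x) y ▸ e hxV
  have : IsRegularRing Γ(Spec (.of k), ⊤) :=
    .of_ringEquiv (Scheme.ΓSpecIso (.of k)).symm.commRingCatIsoToRingEquiv
  algebraize [(s.appLE ⊤ V e).hom]
  have := Algebra.IsStandardSmooth.isRegularLocalRing_localization (R := Γ(Spec (.of k), ⊤))
    (hV.primeIdealOf ⟨x, hxV⟩).asIdeal
  exact .of_ringEquiv (hV.localizationEquivStalk ⟨x, hxV⟩)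

theorem Scheme.Hom.mem_smoothLocus_of_isRegularLocalRing {k : Type} [Field k] [CharZero k]
    {W B : Scheme.{0}} (q : W ⟶ B) [LocallyOfFinitePresentation q] [IsIntegral B]
    (s : B ⟶ Spec (.of k)) (x : W) (hx : q x = genericPoint B)
    [IsRegularLocalRing (W.presheaf.stalk x)] : x ∈ q.smoothLocus := by
  obtain ⟨_, ⟨U, hU, rfl⟩, hxU, -⟩ := B.isBasis_affineOpens.exists_subset_of_mem_open
    (Set.mem_univ (q x)) isOpen_univ
  obtain ⟨_, ⟨V, hV, rfl⟩, hxV, hVU⟩ := W.isBasis_affineOpens.exists_subset_of_mem_open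
    hxU (U.2.preimage q.continuous)
  replace hU : IsAffineOpen U := hU
  replace hV : IsAffineOpen V := hV
  rw [mem_smoothLocus, formallySmooth_stalkMap_iff U hU V hV hVU hxV]
  have := q.finiteType_appLE hU hV hVU
  algebraize [(q.appLE U V hVU).hom]
  have : Nonempty U := ⟨⟨_, hxU⟩⟩
  have : CharZero Γ(B, U) := by
    let φ : k →+* Γ(B, U) := (s.appLE ⊤ U le_top).hom.comp (Scheme.ΓSpecIso (.of k)).inv.hom
    exact charZero_of_injective_ringHom φ.injective
  have h0 : (hV.primeIdealOf ⟨x, hxV⟩).asIdeal.under Γ(B, U) = ⊥ := by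
    have h1 := IsAffineOpen.comap_primeIdealOf_appLE U hU V hV hVU hxV
    have h2 := hU.primeIdealOf_genericPoint
    have h3 : (⟨q x, hVU hxV⟩ : U) = ⟨genericPoint B, hx ▸ hxU⟩ := Subtype.ext hx
    rw [h3, h2, genericPoint_eq_bot_of_affine] at h1
    exact congr($(h1).1)
  have : IsRegularLocalRing (Localization.AtPrime (hV.primeIdealOf ⟨x, hxV⟩).asIdeal) :=
    .of_ringEquiv (R := W.presheaf.stalk x) (hV.localizationEquivStalk ⟨x, hxV⟩).symm
  exact Algebra.FormallySmooth.of_isRegularLocalRing_of_under_eq_bot _ h0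

theorem Smooth.of_isRegularLocalRing_stalk {k : Type} [Field k] [CharZero k] {W : Scheme.{0}}
    (s : W ⟶ Spec (.of k)) [LocallyOfFiniteType s]
    (h : ∀ x, IsRegularLocalRing (W.presheaf.stalk x)) : Smooth s := by
  refine Scheme.Hom.smoothLocus_eq_top_iff.mp (top_le_iff.mp fun x _ ↦ ?_)
  have := h x
  exact s.mem_smoothLocus_of_isRegularLocalRing (𝟙 _) x (Subsingleton.elim _ _)

end AlgebraicGeometry

open Topology in
theorem Topology.IsConstructible.mem_nhds_or_compl_mem_nhds {X : Type*} [TopologicalSpace X]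
    {η : X} (hη : ∀ U : Set X, IsOpen U → U.Nonempty → η ∈ U) {s : Set X}
    (hs : IsConstructible s) : s ∈ 𝓝 η ∨ sᶜ ∈ 𝓝 η := by
  induction hs using IsConstructible.empty_union_induction with
  | open_retrocompact U hU hU' =>
    obtain rfl | h := U.eq_empty_or_nonempty
    · simp
    · exact .inl (hU.mem_nhds (hη U hU h))
  | union s hs t ht hs' ht' =>
    rw [Set.compl_union]
    obtain h | h := hs'
    · exact .inl (Filter.mem_of_superset h Set.subset_union_left)
    · obtain h' | h' := ht'
      · exact .inl (Filter.mem_of_superset h' Set.subset_union_right)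
      · exact .inr (Filter.inter_mem h h')
  | compl s hs hs' => rwa [compl_compl, or_comm]

namespace AlgebraicGeometry

theorem Smooth.morphismRestrict_of_le_smoothLocus {W B : Scheme.{0}} (q : W ⟶ B)
    [LocallyOfFinitePresentation q] (V : B.Opens) (hV : q ⁻¹ᵁ V ≤ q.smoothLocus) :
    Smooth (q ∣_ V) := by
  refine Scheme.Hom.smoothLocus_eq_top_iff.mp (top_le_iff.mp fun x _ ↦ ?_)
  exact (RingHom.FormallySmooth.respectsIso.arrow_mk_iso_iff
    (morphismRestrictStalkMap q V x)).mpr (hV x.2)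

/-- Generic smoothness in characteristic zero. -/
theorem Smooth.exists_morphismRestrict {k : Type} [Field k] [CharZero k] {W B : Scheme.{0}}
    (q : W ⟶ B) [LocallyOfFiniteType q] [QuasiCompact q] [IsIntegral B] [IsNoetherian B]
    (s : B ⟶ Spec (.of k))
    (h : ∀ x, q x = genericPoint B → IsRegularLocalRing (W.presheaf.stalk x)) :
    ∃ V : B.Opens, (V : Set B).Nonempty ∧ Smooth (q ∣_ V) := by
  have : IsLocallyNoetherian W := LocallyOfFiniteType.isLocallyNoetherian q
  have : CompactSpace W := QuasiCompact.compactSpace_of_compactSpace q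
  have : IsNoetherian W := {}
  have hC : Topology.IsConstructible ((q.smoothLocus : Set W)ᶜ) :=
    ((NoetherianSpace.isCompact _).isConstructible q.smoothLocus.2).compl
  have hη := genericPoint_spec B
  have hmem : genericPoint B ∉ q '' (q.smoothLocus : Set W)ᶜ := by
    rintro ⟨x, hx, hxη⟩
    have := h x hxη
    exact hx (q.mem_smoothLocus_of_isRegularLocalRing s x hxη)
  have := ((q.isConstructible_image hC).mem_nhds_or_compl_mem_nhds fun U hU hne ↦
    (hη.mem_open_set_iff hU).mpr (by simpa using hne)).resolve_left
      fun h ↦ hmem (mem_of_mem_nhds h)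
  obtain ⟨V, hVC, hV, hmV⟩ := mem_nhds_iff.mp this
  refine ⟨⟨V, hV⟩, ⟨_, hmV⟩, Smooth.morphismRestrict_of_le_smoothLocus _ _ fun x hx ↦ ?_⟩
  by_contra hx'
  exact hVC hx ⟨x, hx', rfl⟩

end AlgebraicGeometry

theorem CommRingCat.isPushout_quotient_map_ker {R S K : CommRingCat.{0}} (φ : R ⟶ S) (ψ : R ⟶ K)
    (hψ : Function.Surjective ψ) : ∃ κ : K ⟶ .of (S ⧸ (RingHom.ker ψ.hom).map φ.hom),
      IsPushout φ ψ (CommRingCat.ofHom (Ideal.Quotient.mk _)) κ := by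
  let I := (RingHom.ker ψ.hom).map φ.hom
  have hI : ∀ r ∈ RingHom.ker ψ.hom, ((Ideal.Quotient.mk I).comp φ.hom) r = 0 := fun r hr ↦
    Ideal.Quotient.eq_zero_iff_mem.mpr (Ideal.mem_map_of_mem _ hr)
  let κ : K →+* S ⧸ I := RingHom.liftOfSurjective ψ.hom hψ ⟨(Ideal.Quotient.mk I).comp φ.hom, hI⟩
  have hκ : κ.comp ψ.hom = (Ideal.Quotient.mk I).comp φ.hom :=
    RingHom.liftOfRightInverse_comp _ _ _ _
  refine ⟨ofHom κ, ⟨⟨?_⟩, ⟨PushoutCocone.IsColimit.mk _ (fun s ↦ ofHom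
    (Ideal.Quotient.lift I s.inl.hom fun a ha ↦ ?_)) (fun s ↦ ?_) (fun s ↦ ?_) fun s m h₁ h₂ ↦ ?_⟩⟩⟩
  · ext x
    exact congr($hκ x).symm
  · suffices I ≤ RingHom.ker s.inl.hom from this ha
    rw [Ideal.map_le_iff_le_comap]
    intro r hr
    have := congr($(s.condition) r)
    simp only [hom_comp, RingHom.comp_apply] at this
    simp [RingHom.mem_ker, this, RingHom.mem_ker.mp hr]
  · ext x
    rfl
  · ext x
    obtain ⟨r, rfl⟩ := hψ x
    have h₁ := congr($hκ r)
    have h₂ := congr($(s.condition) r)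
    simp only [hom_comp, RingHom.comp_apply] at h₁ h₂ ⊢
    exact congr((Ideal.Quotient.lift I s.inl.hom _) $h₁).trans h₂
  · ext x
    exact congr($h₁ x)

theorem Ideal.height_comap_quotientMk_map {R S : Type*} [CommRing R] [CommRing S] [Algebra R S]
    [Module.Flat R S] [IsNoetherianRing R] [IsNoetherianRing S] (p : Ideal R) [p.IsMaximal]
    (Q : Ideal (S ⧸ p.map (algebraMap R S))) [Q.IsPrime] :
    (Q.comap (Ideal.Quotient.mk _)).height = p.height + Q.height := by
  have : (Q.comap (Ideal.Quotient.mk (p.map (algebraMap R S)))).LiesOver p := by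
    refine ⟨IsMaximal.eq_of_le ‹_› (IsPrime.under R _).ne_top ?_⟩
    rw [Ideal.under_def, ← Ideal.map_le_iff_le_comap]
    intro x hx
    rw [Ideal.mem_comap, Ideal.Quotient.eq_zero_iff_mem.mpr hx]
    exact Q.zero_mem
  rw [Ideal.height_eq_height_add_of_liesOver_of_hasGoingDown p,
    Ideal.map_comap_of_surjective _ Ideal.Quotient.mk_surjective]

namespace AlgebraicGeometry

/-- The dimension formula for flat morphisms, at a point of the fibre over a rational point. -/
theorem Flat.coheight_eq_add_of_isPullback {k : Type} [Field k] {W B F : Scheme.{0}} (q : W ⟶ B)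
    [Flat q] [IsLocallyNoetherian B] [IsLocallyNoetherian W] (s : B ⟶ Spec (.of k)) (b : Spec (.of k) ⟶ B)
    (hb : b ≫ s = 𝟙 _) {i : F ⟶ W} {t : F ⟶ Spec (.of k)} (h : IsPullback i t q b) (x : F) :
    Order.coheight (i x) = Order.coheight (q (i x)) + Order.coheight x := by
  obtain ⟨_, ⟨U, hU, rfl⟩, hxU, -⟩ := B.isBasis_affineOpens.exists_subset_of_mem_open
    (Set.mem_univ (q (i x))) isOpen_univ
  obtain ⟨_, ⟨V, hV, rfl⟩, hxV, hVU⟩ := W.isBasis_affineOpens.exists_subset_of_mem_open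
    hxU (U.2.preimage q.continuous)
  replace hU : IsAffineOpen U := hU
  replace hV : IsAffineOpen V := hV
  let φ := q.appLE U V hVU
  have hφ : Spec.map φ ≫ hU.fromSpec = hV.fromSpec ≫ q := hU.SpecMap_appLE_fromSpec q hV hVU
  have hbx : b (t x) = q (i x) := by
    rw [← Scheme.Hom.comp_apply, ← Scheme.Hom.comp_apply, h.w]
  have hbU : Set.range b ⊆ Set.range hU.fromSpec := by
    rintro _ ⟨y, rfl⟩
    rw [hU.range_fromSpec, Subsingleton.elim y (t x), hbx]
    exact hxU
  obtain ⟨ψ, hψ⟩ := Spec.map_surjective (IsOpenImmersion.lift hU.fromSpec b hbU)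
  have hψb : Spec.map ψ ≫ hU.fromSpec = b := by rw [hψ, IsOpenImmersion.lift_fac]
  obtain ⟨χ, hχ⟩ := Spec.map_surjective (hU.fromSpec ≫ s)
  have hχψ : χ ≫ ψ = 𝟙 _ := by
    rw [← Spec.map_injective.eq_iff, Spec.map_comp, hχ, reassoc_of% hψb, hb, Spec.map_id]
  have hsurj : Function.Surjective ψ := fun y ↦ ⟨χ y, congr($hχψ y)⟩
  obtain ⟨κ, hκ⟩ := CommRingCat.isPushout_quotient_map_ker φ ψ hsurj
  have h₁ := isPullback_SpecMap_of_isPushout _ _ _ _ hκ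
  have h₂ : IsPullback (Spec.map (CommRingCat.ofHom (Ideal.Quotient.mk
      ((RingHom.ker ψ.hom).map φ.hom)))) (Spec.map κ) (hV.fromSpec ≫ q) b := by
    have := IsPullback.of_isLimit (PullbackCone.isLimitOfCompMono _ _ hU.fromSpec _ h₁.isLimit)
    simp only [hψb, hφ] at this
    exact this
  have h₃ := h₂.flip.of_right' h.flip
  set l := h.flip.lift (Spec.map κ) (Spec.map (CommRingCat.ofHom (Ideal.Quotient.mk
      ((RingHom.ker ψ.hom).map φ.hom))) ≫ hV.fromSpec) (by rw [h₂.flip.w, Category.assoc])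
  have : IsOpenImmersion l := MorphismProperty.of_isPullback h₃.flip inferInstance
  obtain ⟨Q, rfl, hQ⟩ := Scheme.exists_preimage_of_isPullback h₃ x (hV.primeIdealOf ⟨i x, hxV⟩)
    (hV.fromSpec_primeIdealOf ⟨i x, hxV⟩).symm
  have : IsNoetherianRing Γ(B, U) := IsLocallyNoetherian.component_noetherian ⟨U, hU⟩
  have : IsNoetherianRing Γ(W, V) := IsLocallyNoetherian.component_noetherian ⟨V, hV⟩
  algebraize [φ.hom]
  have : Module.Flat Γ(B, U) Γ(W, V) := Flat.flat_appLE q hU hV hVU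
  have : (RingHom.ker ψ.hom).IsMaximal := RingHom.ker_isMaximal_of_surjective _ hsurj
  have h₄ : Order.coheight (i (l Q)) = (Q.asIdeal.comap (Ideal.Quotient.mk _)).height := by
    have := coheight_eq_of_isOpenImmersion (x := hV.primeIdealOf ⟨i (l Q), hxV⟩) hV.fromSpec
    rw [hV.fromSpec_primeIdealOf ⟨i (l Q), hxV⟩, ← hQ] at this
    exact this.trans (idealHeight_eq_coheight _ _).symm
  have h₅ : Order.coheight (q (i (l Q))) = (RingHom.ker ψ.hom).height := by
    rw [← hbx, ← hψb, Scheme.Hom.comp_apply]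
    refine (coheight_eq_of_isOpenImmersion hU.fromSpec).trans ?_
    rw [← idealHeight_eq_coheight]
    generalize t (l Q) = y
    have := y.2
    rw [RingHom.ker_eq_comap_bot, ← y.asIdeal.eq_bot_of_prime]
    rfl
  have h₆ : Order.coheight (l Q) = Q.asIdeal.height :=
    (coheight_eq_of_isOpenImmersion l).trans (idealHeight_eq_coheight _ _).symm
  have := Q.2
  rw [h₄, h₅, h₆]
  exact Ideal.height_comap_quotientMk_map (RingHom.ker ψ.hom) Q.asIdeal

end AlgebraicGeometry

theorem topologicalKrullDim_eq_iSup_coheight (X : Type*) [TopologicalSpace X] [QuasiSober X]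
    [T0Space X] [Nonempty X] : letI := specializationOrder X
   
    topologicalKrullDim X = ((⨆ x : X, Order.coheight x : ℕ∞) : WithBot ℕ∞) := by
  let := specializationOrder X
  rw [topologicalKrullDim, Order.krullDim_eq_of_orderIso irreducibleSetEquivPoints,
    Order.krullDim_eq_iSup_coheight_of_nonempty]

/-- If every closed point of a sober Jacobson space has codimension `n`, then every closed subspace
with non-empty interior has dimension `n`. -/
theorem Topology.IsClosedEmbedding.topologicalKrullDim_eq {X W : Type*} [TopologicalSpace X]
    [TopologicalSpace W] [QuasiSober X] [T0Space X] [JacobsonSpace X] {j : W → X}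
    (hj : Topology.IsClosedEmbedding j) {o : Set X} (ho : IsOpen o) (hne : o.Nonempty)
    (hoj : o ⊆ Set.range j) {n : ℕ∞} (h : letI := specializationPreorder X; ∀ x : X, IsClosed {x} → Order.coheight x = n) :
    topologicalKrullDim W = n := by
  have := hj.quasiSober
  have := hj.isEmbedding.t0Space
  let := specializationOrder X
  let := specializationOrder W
  have hle {x y : W} : j x ≤ j y ↔ x ≤ y := hj.isInducing.specializes_iff
  have hlt {x y : W} : j x < j y ↔ x < y := by simp only [lt_iff_le_not_ge, hle]
  have : Nonempty W := (Set.range_nonempty_iff_nonempty.mp (hne.mono hoj))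
  rw [topologicalKrullDim_eq_iSup_coheight, WithBot.coe_inj]
  apply le_antisymm
  · refine iSup_le fun x ↦ ?_
    refine (Order.coheight_le_coheight_apply_of_strictMono j (fun _ _ ↦ hlt.mpr) x).trans ?_
    obtain ⟨z, hz, hzc⟩ := nonempty_inter_closedPoints (Z := closure {j x})
      (by simp) isClosed_closure.isLocallyClosed
    rw [← h z hzc]
    exact Order.coheight_anti (specializes_iff_mem_closure.mpr hz)
  · obtain ⟨x, hx, hxc⟩ := nonempty_inter_closedPoints hne ho.isLocallyClosed
    obtain ⟨x, rfl⟩ := hoj hx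
    refine le_iSup_of_le x ?_
    rw [← h _ hxc]
    refine Order.coheight_le fun p hp ↦ ?_
    have hmem (a) : p a ∈ o := by
      have : p.head ≤ p a := p.monotone (Fin.zero_le a)
      rw [hp] at this
      exact Specializes.mem_open this ho hx
    choose q hq using fun a ↦ hoj (hmem a)
    refine Order.length_le_coheight (p := ⟨p.length, q, fun a ↦ ?_⟩) ?_
    · change q _ < q _
      rw [← hlt, hq, hq]
      exact p.step a
    · change x ≤ q 0
      rw [← hle, hq, ← hp]
      rfl

namespace AlgebraicGeometry

theorem IsAffineOpen.coheight_eq_ringKrullDim {k : Type} [Field k] {X : Scheme.{0}}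
    (s : X ⟶ Spec (.of k)) [LocallyOfFiniteType s] [IsIntegral X] {U : X.Opens}
    (hU : IsAffineOpen U) {x : X} (hxU : x ∈ U) (hx : IsClosed {x}) :
    (Order.coheight x : WithBot ℕ∞) = ringKrullDim Γ(X, U) := by
  have : Nonempty U := ⟨x, hxU⟩
  have := hU.primeIdealOf_isMaximal_of_isClosed ⟨x, hxU⟩ hx
  have hft := LocallyOfFiniteType.finiteType_appLE s (isAffineOpen_top _) hU le_top
  let φ : k →+* Γ(X, U) := (s.appLE ⊤ U le_top).hom.comp (Scheme.ΓSpecIso (.of k)).inv.hom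
  have hφ : φ.FiniteType := hft.comp <| .of_surjective _
    (Scheme.ΓSpecIso (.of k)).symm.commRingCatIsoToRingEquiv.surjective
  algebraize [φ]
  rw [← Ideal.height_eq_ringKrullDim_of_finiteType k _ (hU.primeIdealOf ⟨x, hxU⟩).asIdeal]
  have := coheight_eq_of_isOpenImmersion (x := hU.primeIdealOf ⟨x, hxU⟩) hU.fromSpec
  rw [hU.fromSpec_primeIdealOf ⟨x, hxU⟩] at this
  exact congrArg _ (this.trans (idealHeight_eq_coheight _ _).symm)

theorem coheight_eq_topologicalKrullDim {k : Type} [Field k] {X : Scheme.{0}}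
    (s : X ⟶ Spec (.of k)) [LocallyOfFiniteType s] [IsIntegral X] {x : X} (hx : IsClosed {x}) :
    (Order.coheight x : WithBot ℕ∞) = topologicalKrullDim X := by
  have := LocallyOfFiniteType.jacobsonSpace s
  refine (Topology.IsClosedEmbedding.id.topologicalKrullDim_eq isOpen_univ Set.univ_nonempty
    (by simp) fun y hy ↦ ?_).symm
  obtain ⟨_, ⟨U, hU, rfl⟩, hxU, -⟩ := X.isBasis_affineOpens.exists_subset_of_mem_open
    (Set.mem_univ x) isOpen_univ
  obtain ⟨_, ⟨V, hV, rfl⟩, hyV, -⟩ := X.isBasis_affineOpens.exists_subset_of_mem_open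
    (Set.mem_univ y) isOpen_univ
  obtain ⟨z, hz, hzc⟩ := nonempty_inter_closedPoints
    (nonempty_preirreducible_inter U.2 V.2 ⟨x, hxU⟩ ⟨y, hyV⟩) (U.2.inter V.2).isLocallyClosed
  rw [← WithBot.coe_inj]
  exact ((IsAffineOpen.coheight_eq_ringKrullDim s hV hyV hy).trans
    (IsAffineOpen.coheight_eq_ringKrullDim s hV hz.2 hzc).symm).trans
    ((IsAffineOpen.coheight_eq_ringKrullDim s hU hz.1 hzc).trans
    (IsAffineOpen.coheight_eq_ringKrullDim s hU hxU hx).symm)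

theorem topologicalKrullDim_eq_of_mem_irreducibleComponents {k : Type} [Field k] {F : Scheme.{0}}
    (s : F ⟶ Spec (.of k)) [LocallyOfFiniteType s] [QuasiCompact s] {n : ℕ∞}
    (h : ∀ x : F, IsClosed {x} → Order.coheight x = n) {W : Set F}
    (hW : W ∈ irreducibleComponents F) : topologicalKrullDim W = n := by
  have := LocallyOfFiniteType.jacobsonSpace s
  have := LocallyOfFiniteType.isLocallyNoetherian s
  have := QuasiCompact.compactSpace_of_compactSpace s
  have : IsNoetherian F := {}
  obtain ⟨o, ho, hne, hoW⟩ := NoetherianSpace.exists_isOpen_nonempty_subset_irreducibleComponent W hW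
  exact (isClosed_of_mem_irreducibleComponents W hW).isClosedEmbedding_subtypeVal
    |>.topologicalKrullDim_eq ho hne (by simpa using hoW) h

end AlgebraicGeometry

section

attribute [local simp] pullback.lift_fst pullback.lift_snd pullback.lift_fst_assoc
  pullback.lift_snd_assoc

variable {C : Type*} [Category* C] [HasPullbacks C] {S G M X Y Z : C}

/-- `act` is an action of the group object `G` over `S` on the object `M` over `S`, in terms of
generalized points. -/
structure IsGroupAction (sG : G ⟶ S) (mul : pullback sG sG ⟶ G) (e : S ⟶ G) (sM : M ⟶ S)
    (act : pullback sG sM ⟶ M) : Prop where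
  comp_eq : act ≫ sM = pullback.snd sG sM ≫ sM
  one_act (T : C) (x : T ⟶ M) (h) : pullback.lift (x ≫ sM ≫ e) x h ≫ act = x
  mul_act (T : C) (a b : T ⟶ G) (x : T ⟶ M) (hab : a ≫ sG = b ≫ sG) (hbx : b ≫ sG = x ≫ sM)
    (h₁ h₂) : pullback.lift (pullback.lift a b hab ≫ mul) x h₁ ≫ act =
      pullback.lift a (pullback.lift b x hbx ≫ act) h₂ ≫ act

/-- Translation by a section `h` of `G`. -/
noncomputable def translation {sG : G ⟶ S} {sM : M ⟶ S} (act : pullback sG sM ⟶ M) (h : S ⟶ G)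
    (hh : h ≫ sG = 𝟙 S) : M ⟶ M :=
  pullback.lift (sM ≫ h) (𝟙 M) (by simp [hh]) ≫ act

variable {sG : G ⟶ S} {sM : M ⟶ S} {sX : X ⟶ S} {sY : Y ⟶ S} {mul : pullback sG sG ⟶ G} {e : S ⟶ G}
  {act : pullback sG sM ⟶ M} {actX : pullback sG sX ⟶ X}

theorem comp_translation {T : C} (act : pullback sG sM ⟶ M) (h : S ⟶ G) (hh : h ≫ sG = 𝟙 S)
    (x : T ⟶ M) : x ≫ translation act h hh =
      pullback.lift (x ≫ sM ≫ h) x (by simp [hh]) ≫ act := by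
  rw [translation, ← Category.assoc]
  congr 1
  ext <;> simp

namespace IsGroupAction

theorem translation_comp (H : IsGroupAction sG mul e sM act) (h : S ⟶ G) (hh : h ≫ sG = 𝟙 S) :
    translation act h hh ≫ sM = sM := by
  rw [translation, Category.assoc, H.comp_eq, pullback.lift_snd_assoc, Category.id_comp]

theorem translation_comp_translation (H : IsGroupAction sG mul e sM act) (h h' : S ⟶ G)
    (hh : h ≫ sG = 𝟙 S) (hh' : h' ≫ sG = 𝟙 S)
    (he : e ≫ sG = 𝟙 S) (hmul : pullback.lift h h' (hh.trans hh'.symm) ≫ mul = e) :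
    translation act h' hh' ≫ translation act h hh = 𝟙 M := by
  have h₁ : pullback.lift (sM ≫ h) (sM ≫ h') (by simp [hh, hh']) ≫ mul = sM ≫ e := by
    rw [← hmul]
    refine Eq.trans ?_ (Category.assoc _ _ _)
    congr 1
    ext <;> simp
  have h₂ := H.mul_act M (sM ≫ h) (sM ≫ h') (𝟙 M) (by simp [hh, hh']) (by simp [hh'])
    (by simp [h₁, he]) (by simp [H.comp_eq, hh])
  have h₃ := H.one_act M (𝟙 M) (by simp [he])
  simp only [h₁] at h₂
  simp only [Category.id_comp] at h₃
  rw [h₃] at h₂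
  rw [comp_translation]
  simp only [← Category.assoc (translation _ _ _), H.translation_comp]
  exact h₂.symm

theorem isIso_translation (H : IsGroupAction sG mul e sM act) (he : e ≫ sG = 𝟙 S)
    {inv : G ⟶ G} (hinvS : inv ≫ sG = sG)
    (hinv : ∀ (T : C) (a : T ⟶ G) h, pullback.lift a (a ≫ inv) h ≫ mul = a ≫ sG ≫ e)
    (h : S ⟶ G) (hh : h ≫ sG = 𝟙 S) : IsIso (translation act h hh) := by
  have key (a : S ⟶ G) (ha : a ≫ sG = 𝟙 S) : translation act (a ≫ inv) (by simp [hinvS, ha]) ≫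
      translation act a ha = 𝟙 M :=
    H.translation_comp_translation _ _ _ _ he (by rw [hinv, reassoc_of% ha])
  have h₁ := key h hh
  have h₂ := key (h ≫ inv) (by simp [hinvS, hh])
  have : IsSplitMono (translation act (h ≫ inv) (by simp [hinvS, hh])) := ⟨⟨_, h₁⟩⟩
  have : IsSplitEpi (translation act (h ≫ inv) (by simp [hinvS, hh])) := ⟨⟨_, h₂⟩⟩
  have : IsIso (translation act (h ≫ inv) (by simp [hinvS, hh])) := isIso_of_mono_of_isSplitEpi _
  exact IsIso.of_isIso_fac_left h₁

/-- The orbit map `(g, y) ↦ g • f y`. -/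
noncomputable def _root_.orbitMap (act : pullback sG sM ⟶ M) (f : Y ⟶ M) :
    pullback sG (f ≫ sM) ⟶ M :=
  pullback.lift (pullback.fst _ _) (pullback.snd _ _ ≫ f) (by simp [pullback.condition]) ≫ act

/-- The orbit map is equivariant. -/
theorem map_translation_comp_orbitMap (H : IsGroupAction sG mul e sM act)
    (Hmul : IsGroupAction sG mul e sG mul) (f : Y ⟶ M) (h : S ⟶ G) (hh : h ≫ sG = 𝟙 S) :
    pullback.map sG (f ≫ sM) sG (f ≫ sM) (translation mul h hh) (𝟙 Y) (𝟙 S)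
      (by simp [Hmul.translation_comp]) (by simp) ≫ orbitMap act f =
    orbitMap act f ≫ translation act h hh := by
  rw [comp_translation]
  have h₁ := H.mul_act _ (pullback.fst sG (f ≫ sM) ≫ sG ≫ h) (pullback.fst _ _)
    (pullback.snd sG (f ≫ sM) ≫ f) (by simp [hh]) (by simp [pullback.condition])
    (by simp [Hmul.comp_eq, pullback.condition]) (by simp [H.comp_eq, hh, pullback.condition])
  have h₂ : (orbitMap act f) ≫ sM = pullback.fst _ _ ≫ sG := by
    simp [orbitMap, H.comp_eq, pullback.condition]
  simp only [reassoc_of% h₂]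
  refine Eq.trans ?_ h₁
  unfold orbitMap
  rw [← Category.assoc]
  congr 1
  ext
  · simp [comp_translation, pullback.map]
  · simp [pullback.map]

/-- The fibre over a section `σ` of the family whose members are the fibre products of the
translates of `f` with `g`. -/
theorem _root_.exists_isPullback_orbitMap (act : pullback sG sM ⟶ M) (f : Y ⟶ M) (g : Z ⟶ M)
    (σ : S ⟶ G) (hσ : σ ≫ sG = 𝟙 S) (w : (f ≫ sM ≫ σ) ≫ sG = f ≫ sM) :
    ∃ i : pullback (pullback.lift (f ≫ sM ≫ σ) f w ≫ act) g ⟶ pullback (orbitMap act f) g,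
      IsPullback i (pullback.fst _ _ ≫ f ≫ sM)
        (pullback.fst (orbitMap act f) g ≫ pullback.fst sG (f ≫ sM)) σ := by
  have w' : ((f ≫ sM) ≫ σ) ≫ sG = 𝟙 Y ≫ f ≫ sM := by simp [hσ]
  let ψ : Y ⟶ pullback sG (f ≫ sM) := pullback.lift ((f ≫ sM) ≫ σ) (𝟙 Y) w'
  have h₁ : IsPullback ψ (f ≫ sM) (pullback.fst sG (f ≫ sM)) σ := by
    refine IsPullback.of_right (h₁₂ := pullback.snd _ _) (h₂₂ := sG) (v₁₃ := f ≫ sM) ?_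
      (by simp [ψ]) (IsPullback.of_hasPullback _ _).flip
    simpa [ψ, hσ] using IsPullback.of_id_fst (f := f ≫ sM)
  have h₂ : ψ ≫ orbitMap act f = pullback.lift (f ≫ sM ≫ σ) f w ≫ act := by
    rw [orbitMap, ← Category.assoc]
    congr 1
    ext <;> simp [ψ]
  refine ⟨pullback.lift (pullback.fst _ _ ≫ ψ) (pullback.snd _ _)
    (by simp [h₂, pullback.condition]), .paste_vert ?_ h₁⟩
  refine IsPullback.of_right (h₁₂ := pullback.snd _ _) (h₂₂ := orbitMap act f) (v₁₃ := g) ?_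
    (by simp) (IsPullback.of_hasPullback _ _).flip
  simpa only [h₂, pullback.lift_snd] using
    (IsPullback.of_hasPullback (pullback.lift (f ≫ sM ≫ σ) f w ≫ act) g).flip

end IsGroupAction
end

namespace AlgebraicGeometry

universe u
variable {k : Type u} [Field k]

/-- A property of morphisms that holds over a nonempty open subset of a homogeneous target holds
everywhere. -/
theorem of_morphismRestrict_of_homogeneous (P : MorphismProperty Scheme.{u})
    [IsZariskiLocalAtTarget P] [P.IsStableUnderBaseChange] {M X : Scheme.{u}} (Φ : M ⟶ X)
    (s : X ⟶ Spec (.of k)) [LocallyOfFiniteType s] (V : X.Opens) (hV : (V : Set X).Nonempty)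
    (hP : P (Φ ∣_ V))
    (H : ∀ x v : X, IsClosed {x} → IsClosed {v} → ∃ (τ : X ⟶ X) (τ' : M ⟶ M),
      IsIso τ ∧ IsIso τ' ∧ τ' ≫ Φ = Φ ≫ τ ∧ τ x = v) : P Φ := by
  have := LocallyOfFiniteType.jacobsonSpace s
  obtain ⟨v, hvV, hv⟩ := nonempty_inter_closedPoints hV V.2.isLocallyClosed
  have key (x : X) (hx : IsClosed {x}) : ∃ U : X.Opens, x ∈ U ∧ P (Φ ∣_ U) := by
    obtain ⟨τ, τ', _, _, hτ, hx'⟩ := H x v hx hv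
    refine ⟨τ ⁻¹ᵁ V, by simpa [hx'] using hvV, ?_⟩
    have h₁ : IsPullback τ' Φ Φ τ := .of_horiz_isIso ⟨hτ⟩
    have h₂ := (isPullback_morphismRestrict Φ (τ ⁻¹ᵁ V)).flip.paste_horiz h₁
    rw [← morphismRestrict_ι] at h₂
    exact MorphismProperty.of_isPullback
      (IsPullback.of_right' h₂ (isPullback_morphismRestrict Φ V).flip) hP
  choose! U hxU hU using key
  refine IsZariskiLocalAtTarget.of_iSup_eq_top (P := P)
    (fun x : {x : X // IsClosed {x}} ↦ U x) ?_ fun x ↦ hU x x.2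
  rw [← Opens.coe_eq_univ, ← not_ne_iff, ← Set.nonempty_compl]
  intro hne
  obtain ⟨x, hx, hxc⟩ := nonempty_inter_closedPoints hne
    (Opens.isOpen _).isClosed_compl.isLocallyClosed
  exact hx (by simpa using ⟨x, hxc, hxU x hxc⟩)

variable [IsAlgClosed k] {G X Y : Scheme.{u}} {sG : G ⟶ Spec (.of k)} {sX : X ⟶ Spec (.of k)}
  {mul : pullback sG sG ⟶ G} {e : Spec (.of k) ⟶ G} {act : pullback sG sX ⟶ X}

/-- A group acting transitively acts transitively on closed points. -/
theorem exists_translation_apply_eq [LocallyOfFiniteType sG] [LocallyOfFiniteType sX]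
    (hact : act ≫ sX = pullback.snd sG sX ≫ sX)
    (htrans : Function.Surjective (pullback.lift (f := sX) (g := sX) act (pullback.snd sG sX) hact))
    {x v : X} (hx : IsClosed {x}) (hv : IsClosed {v}) :
    ∃ (h : Spec (.of k) ⟶ G) (hh : h ≫ sG = 𝟙 _), translation act h hh x = v := by
  let px := pointOfClosedPoint sX x hx
  let pv := pointOfClosedPoint sX v hv
  let a := pullback.lift (f := sX) (g := sX) act (pullback.snd sG sX) hact
  let sXX := pullback.fst sX sX ≫ sX
  let sGX := pullback.fst sG sX ≫ sG
  have : JacobsonSpace ↑(pullback sG sX) := LocallyOfFiniteType.jacobsonSpace sGX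
  let pw : Spec (.of k) ⟶ pullback sX sX := pullback.lift pv px (by simp [px, pv])
  have hpw : pw ≫ sXX = 𝟙 _ := by simp [pw, sXX, pullback.lift_fst_assoc, pv]
  obtain ⟨o, ho⟩ : ∃ o : Spec (.of k), o = IsLocalRing.closedPoint k := ⟨_, rfl⟩
  obtain ⟨w, hw⟩ : ∃ w, w = pw o := ⟨_, rfl⟩
  have hwc : IsClosed {w} := hw ▸ ho ▸ (pointEquivClosedPoint sXX ⟨pw, hpw⟩).2
  have hfib : IsClosed (a ⁻¹' {w}) := hwc.preimage a.continuous
  obtain ⟨m, hm, hmc⟩ := nonempty_inter_closedPoints (Set.singleton_nonempty w |>.preimage htrans)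
    hfib.isLocallyClosed
  let pm := pointOfClosedPoint sGX m hmc
  have hpm : pm ≫ sGX = 𝟙 _ := pointOfClosedPoint_comp _ _ _
  have hma : pm ≫ a = pw := by
    refine ext_of_apply_closedPoint_eq sXX ?_ hpw (ho ▸ ?_)
    · rw [Category.assoc, ← hpm]
      congr 1
      simp only [a, sXX, sGX, pullback.lift_fst_assoc]
      rw [hact, pullback.condition]
    · rw [Scheme.Hom.comp_apply, show pm o = m from pointOfClosedPoint_apply .., ← hw]
      exact hm
  have h₁ : pm ≫ act = pv := by
    simpa [a, pw, pullback.lift_fst] using congr($hma ≫ pullback.fst _ _)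
  have h₂ : pm ≫ pullback.snd _ _ = px := by
    simpa [a, pw, pullback.lift_snd] using congr($hma ≫ pullback.snd _ _)
  have hh : (pm ≫ pullback.fst _ _) ≫ sG = 𝟙 _ := by simpa [sGX] using hpm
  refine ⟨pm ≫ pullback.fst _ _, hh, ?_⟩
  have h₃ : px ≫ translation act (pm ≫ pullback.fst _ _) hh = pv := by
    rw [comp_translation, ← h₁]
    congr 1
    ext
    · simp [pullback.lift_fst, px]
    · simp [pullback.lift_snd, h₂]
  simpa [px, pv, Scheme.Hom.comp_apply] using congr($h₃ o)

/-- A reduced group scheme locally of finite type over an algebraically closed field is smooth. -/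
theorem IsGroupAction.smooth [LocallyOfFiniteType sG] [IsReduced G]
    (H : IsGroupAction sG mul e sG mul) (he : e ≫ sG = 𝟙 _) {inv : G ⟶ G} (hinvS : inv ≫ sG = sG)
    (hinv : ∀ (T : Scheme) (a : T ⟶ G) h, pullback.lift a (a ≫ inv) h ≫ mul = a ≫ sG ≫ e)
    (hone' : ∀ (T : Scheme) (a : T ⟶ G) h, pullback.lift a (a ≫ sG ≫ e) h ≫ mul = a) :
    Smooth sG := by
  have := LocallyOfFiniteType.jacobsonSpace sG
  obtain ⟨o⟩ : Nonempty (Spec (.of k)) := inferInstance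
  have : Nonempty G := ⟨e o⟩
  rw [← Scheme.Hom.smoothLocus_eq_top_iff, ← TopologicalSpace.Opens.coe_eq_univ,
    ← not_ne_iff, ← Set.nonempty_compl]
  intro hne
  obtain ⟨x, hx, hxc⟩ :=
    nonempty_inter_closedPoints hne sG.smoothLocus.2.isClosed_compl.isLocallyClosed
  obtain ⟨y, hy : y ∈ sG.smoothLocus, hyc⟩ := nonempty_inter_closedPoints
    sG.dense_smoothLocus_of_perfectField.nonempty sG.smoothLocus.2.isLocallyClosed
  have key (z : G) (hz : IsClosed {z}) : ∃ τ : G ⟶ G, IsIso τ ∧ τ ≫ sG = sG ∧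
      τ (e o) = z := by
    let p := pointOfClosedPoint sG z hz
    have hp : p ≫ sG = 𝟙 _ := pointOfClosedPoint_comp _ _ _
    refine ⟨translation mul p hp, H.isIso_translation he hinvS hinv p hp,
      H.translation_comp _ _, ?_⟩
    have h₁ : e ≫ translation mul p hp = p := by
      rw [comp_translation]
      refine Eq.trans ?_ (hone' _ p (by simp [hp, he]))
      congr 1
      ext
      · simp [reassoc_of% he, pullback.lift_fst]
      · simp [reassoc_of% hp, pullback.lift_snd]
    simpa [p, Scheme.Hom.comp_apply] using congr($h₁ o)
  obtain ⟨τ, _, hτ, hτx⟩ := key x hxc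
  obtain ⟨τ', _, hτ', hτy⟩ := key y hyc
  have hα : (CategoryTheory.inv τ ≫ τ') x = y := by
    rw [← hτx, ← hτy, ← Scheme.Hom.comp_apply, IsIso.hom_inv_id_assoc]
  have hα' : (CategoryTheory.inv τ ≫ τ') ≫ sG = sG := by
    rw [Category.assoc, hτ', IsIso.inv_comp_eq, hτ]
  have hmem : x ∈ (CategoryTheory.inv τ ≫ τ') ⁻¹ᵁ sG.smoothLocus := by
    rwa [Scheme.Hom.mem_preimage, hα]
  rw [Scheme.Hom.preimage_smoothLocus_eq] at hmem
  simp only [hα'] at hmem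
  exact hx hmem

end AlgebraicGeometry

namespace AlgebraicGeometry

variable {k : Type} [Field k]

theorem isPullback_of_morphismRestrict {W B F S : Scheme.{0}} {q : W ⟶ B} {i : F ⟶ W} {t : F ⟶ S}
    {σ : S ⟶ B} (h : IsPullback i t q σ) (V : B.Opens) (hσ : ∀ p, σ p ∈ V) :
    ∃ (i' : F ⟶ (q ⁻¹ᵁ V : W.Opens)) (σ' : S ⟶ V), i' ≫ (q ⁻¹ᵁ V).ι = i ∧ σ' ≫ V.ι = σ ∧
      IsPullback i' t (q ∣_ V) σ' := by
  have hσV : Set.range σ ⊆ Set.range V.ι := by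
    rintro _ ⟨p, rfl⟩
    simpa using hσ p
  obtain ⟨σ', rfl⟩ : ∃ σ' : S ⟶ V, σ' ≫ V.ι = σ :=
    ⟨IsOpenImmersion.lift V.ι σ hσV, IsOpenImmersion.lift_fac _ _ _⟩
  have h' := isPullback_morphismRestrict q V
  exact ⟨h'.lift (t ≫ σ') i (by simpa using h.w.symm), σ', by simp, rfl,
    .of_right (by simpa using h) (by simp) h'.flip⟩

theorem Flat.coheight_eq_add_of_isPullback_of_morphismRestrict {W B F : Scheme.{0}} (q : W ⟶ B)
    (V : B.Opens) [Flat (q ∣_ V)] [IsLocallyNoetherian B] [IsLocallyNoetherian W]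
    (s : B ⟶ Spec (.of k)) (b : Spec (.of k) ⟶ B) (hb : b ≫ s = 𝟙 _) (hbV : ∀ p, b p ∈ V)
    {i : F ⟶ W} {t : F ⟶ Spec (.of k)} (h : IsPullback i t q b) (x : F) :
    Order.coheight (i x) = Order.coheight (q (i x)) + Order.coheight x := by
  obtain ⟨i', b', rfl, rfl, h'⟩ := isPullback_of_morphismRestrict h V hbV
  have key := Flat.coheight_eq_add_of_isPullback (q ∣_ V) (V.ι ≫ s) b' (by simpa using hb) h' x
  rw [← coheight_eq_of_isOpenImmersion V.ι, ← coheight_eq_of_isOpenImmersion (q ⁻¹ᵁ V).ι,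
    ← Scheme.Hom.comp_apply (q ∣_ V), morphismRestrict_ι] at key
  exact key

theorem exists_topologicalKrullDim_eq {X : Scheme.{0}} (s : X ⟶ Spec (.of k))
    [LocallyOfFiniteType s] [IsIntegral X] : ∃ n : ℕ, topologicalKrullDim X = n ∧
      ∀ x : X, IsClosed {x} → Order.coheight x = n := by
  have := LocallyOfFiniteType.jacobsonSpace s
  have := LocallyOfFiniteType.isLocallyNoetherian s
  obtain ⟨x, -, hx⟩ := nonempty_inter_closedPoints (X := X) Set.univ_nonempty
    isClosed_univ.isLocallyClosed
  have h₁ := coheight_eq_topologicalKrullDim s hx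
  have h₂ := ringKrullDim_lt_top (R := X.presheaf.stalk x)
  rw [ringKrullDim_stalk_eq_coheight] at h₂
  obtain ⟨n, hn⟩ := ENat.ne_top_iff_exists.mp (show Order.coheight x ≠ ⊤ by
    rintro h
    exact absurd h₂ (by rw [h]; exact lt_irrefl _))
  refine ⟨n, by rw [← h₁, ← hn]; rfl, fun y hy ↦ ?_⟩
  rw [hn]
  exact_mod_cast (coheight_eq_topologicalKrullDim s hy).trans h₁.symm

variable [IsAlgClosed k]

theorem isClosed_singleton_apply {X Y : Scheme.{0}} (s : Y ⟶ Spec (.of k)) [LocallyOfFiniteType s]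
    (φ : X ⟶ Y) [LocallyOfFiniteType (φ ≫ s)] {x : X} (hx : IsClosed {x}) : IsClosed {φ x} := by
  obtain ⟨o⟩ : Nonempty (Spec (.of k)) := inferInstance
  have h₁ : (pointOfClosedPoint (φ ≫ s) x hx ≫ φ) o = φ x := by
    rw [Scheme.Hom.comp_apply, pointOfClosedPoint_apply]
  rw [← h₁, Subsingleton.elim o (IsLocalRing.closedPoint k)]
  exact (pointEquivClosedPoint s ⟨pointOfClosedPoint (φ ≫ s) x hx ≫ φ, by simp⟩).2

end AlgebraicGeometry

namespace AlgebraicGeometry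

variable {k : Type} [Field k] [IsAlgClosed k] {G X Y Z F : Scheme.{0}} {sG : G ⟶ Spec (.of k)}
  {sX : X ⟶ Spec (.of k)} {sY : Y ⟶ Spec (.of k)} {sZ : Z ⟶ Spec (.of k)}

/-- In a flat base change `φ'` of `φ`, the codimension of a closed point over a closed point of the
base is computed in the fibre. -/
theorem Flat.exists_mem_fiber {W Z X M : Scheme.{0}} {p : W ⟶ M} {φ' : W ⟶ Z}
    {φ : M ⟶ X} {g : Z ⟶ X} (h : IsPullback p φ' φ g) [Flat φ] (s : X ⟶ Spec (.of k))
    [LocallyOfFiniteType s] [LocallyOfFiniteType (g ≫ s)] [IsLocallyNoetherian M]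
    [IsLocallyNoetherian W] (w : W) (hw : IsClosed {φ' w}) :
    ∃ c : ℕ∞, Order.coheight w = Order.coheight (φ' w) + c ∧
      Order.coheight (p w) = Order.coheight (g (φ' w)) + c := by
  have := LocallyOfFiniteType.isLocallyNoetherian s
  have := LocallyOfFiniteType.isLocallyNoetherian (g ≫ s)
  have : Flat φ' := MorphismProperty.of_isPullback h inferInstance
  obtain ⟨o⟩ : Nonempty (Spec (.of k)) := inferInstance
  let b := pointOfClosedPoint (g ≫ s) (φ' w) hw
  have hb : b ≫ g ≫ s = 𝟙 _ := pointOfClosedPoint_comp _ _ _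
  have h₁ := IsPullback.of_hasPullback φ' b
  obtain ⟨w', hw', -⟩ := Scheme.exists_preimage_of_isPullback h₁ w o (by simp [b])
  have h₂ := h₁.flip.paste_vert h.flip
  have h₄ := Flat.coheight_eq_add_of_isPullback φ' (g ≫ s) b hb h₁ w'
  rw [hw'] at h₄
  refine ⟨Order.coheight w', h₄, ?_⟩
  have h₃ := Flat.coheight_eq_add_of_isPullback φ s (b ≫ g) (by simpa) h₂.flip w'
  rwa [Scheme.Hom.comp_apply, ← Scheme.Hom.comp_apply p, h.w, Scheme.Hom.comp_apply φ', hw'] at h₃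

/-- Codimensions of closed points are additive on products over a field. -/
theorem coheight_eq_add_of_isClosed [LocallyOfFiniteType sG] [LocallyOfFiniteType sY]
    (m : ↑(pullback sG sY)) (hm : IsClosed {m}) : Order.coheight m =
      Order.coheight (pullback.snd sG sY m) + Order.coheight (pullback.fst sG sY m) := by
  have := LocallyOfFiniteType.isLocallyNoetherian sY
  have := LocallyOfFiniteType.isLocallyNoetherian (pullback.snd sG sY ≫ sY)
  have hm' := isClosed_singleton_apply sY (pullback.snd sG sY) hm
  obtain ⟨o⟩ : Nonempty (Spec (.of k)) := inferInstance
  let b := pointOfClosedPoint sY _ hm'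
  have hb : b ≫ sY = 𝟙 _ := pointOfClosedPoint_comp _ _ _
  have h : IsPullback (pullback.lift (𝟙 G) (sG ≫ b) (by simp [hb])) sG (pullback.snd sG sY) b := by
    refine IsPullback.of_right (h₁₂ := pullback.fst _ _) (h₂₂ := sY) (v₁₃ := sG) ?_
      (by simp [pullback.lift_snd]) (IsPullback.of_hasPullback _ _)
    simpa [pullback.lift_fst, hb] using IsPullback.of_id_fst (f := sG)
  obtain ⟨γ, hγ, -⟩ := Scheme.exists_preimage_of_isPullback h m o (by simp [b])
  have hγ' : pullback.fst sG sY m = γ := by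
    rw [← hγ, ← Scheme.Hom.comp_apply, pullback.lift_fst]
    rfl
  have key := Flat.coheight_eq_add_of_isPullback (pullback.snd sG sY) sY b hb h γ
  rwa [hγ, ← hγ'] at key

end AlgebraicGeometry

namespace AlgebraicGeometry

variable {k : Type} [Field k] [IsAlgClosed k] {G X Y Z F : Scheme.{0}} {sG : G ⟶ Spec (.of k)}
  {sX : X ⟶ Spec (.of k)} {sY : Y ⟶ Spec (.of k)}

/-- The dimension of a general member of the family of fibre products of a flat family of
morphisms to `X` with `g : Z ⟶ X`. -/
theorem topologicalKrullDim_add_eq_of_flat [LocallyOfFiniteType sG] [LocallyOfFiniteType sX]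
    [LocallyOfFiniteType sY] [IsIntegral G] [IsIntegral X] [IsIntegral Y] [IsIntegral Z]
    (Φ : pullback sG sY ⟶ X) [Flat Φ] (hΦ : Φ ≫ sX = pullback.fst sG sY ≫ sG) (g : Z ⟶ X)
    [LocallyOfFiniteType g] (V : G.Opens)
    [Flat ((pullback.fst Φ g ≫ pullback.fst sG sY) ∣_ V)] {σ : Spec (.of k) ⟶ G}
    (hσ : σ ≫ sG = 𝟙 _) (hσV : ∀ p, σ p ∈ V) {i : F ⟶ pullback Φ g} {t : F ⟶ Spec (.of k)}
    [LocallyOfFiniteType t] [QuasiCompact t]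
    (h : IsPullback i t (pullback.fst Φ g ≫ pullback.fst sG sY) σ) {W : Set F}
    (hW : W ∈ irreducibleComponents F) :
    topologicalKrullDim W + topologicalKrullDim X =
      topologicalKrullDim Y + topologicalKrullDim Z := by
  let q := pullback.fst Φ g ≫ pullback.fst sG sY
  have hq : q ≫ sG = pullback.snd Φ g ≫ g ≫ sX := by
    simp only [q, Category.assoc, ← hΦ, pullback.condition_assoc]
  have : LocallyOfFiniteType (Φ ≫ sX) := hΦ ▸ inferInstance
  have : LocallyOfFiniteType Φ := locallyOfFiniteType_of_comp Φ sX
  have hit : i ≫ q ≫ sG = t := by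
    rw [← Category.assoc, h.w, Category.assoc, hσ, Category.comp_id]
  have : LocallyOfFiniteType (q ≫ sG) := hq ▸ inferInstance
  have := LocallyOfFiniteType.isLocallyNoetherian sG
  have := LocallyOfFiniteType.isLocallyNoetherian (pullback.snd sG sY ≫ sY)
  have := LocallyOfFiniteType.isLocallyNoetherian (q ≫ sG)
  obtain ⟨dG, -, hdG⟩ := exists_topologicalKrullDim_eq sG
  obtain ⟨dX, hX, hdX⟩ := exists_topologicalKrullDim_eq sX
  obtain ⟨dY, hY, hdY⟩ := exists_topologicalKrullDim_eq sY
  obtain ⟨dZ, hZ, hdZ⟩ := exists_topologicalKrullDim_eq (g ≫ sX)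
  have key (x : F) (hx : IsClosed {x}) : Order.coheight x + dX = dY + dZ := by
    have : LocallyOfFiniteType (i ≫ q ≫ sG) := hit ▸ inferInstance
    have : LocallyOfFiniteType (pullback.fst Φ g ≫ pullback.snd sG sY ≫ sY) := by
      rw [← pullback.condition]; simpa [q] using ‹LocallyOfFiniteType (q ≫ sG)›
    have : LocallyOfFiniteType (pullback.snd Φ g ≫ g ≫ sX) := inferInstance
    have hw : IsClosed {i x} := isClosed_singleton_apply (q ≫ sG) i hx
    have hz := isClosed_singleton_apply (g ≫ sX) (pullback.snd Φ g) hw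
    have hm := isClosed_singleton_apply (pullback.snd sG sY ≫ sY) (pullback.fst Φ g) hw
    have hy := isClosed_singleton_apply sY (pullback.snd sG sY) hm
    have : LocallyOfFiniteType (pullback.fst sG sY ≫ sG) := inferInstance
    have hγ := isClosed_singleton_apply sG (pullback.fst sG sY) hm
    have hgz := isClosed_singleton_apply sX g hz
    have h₁ := Flat.coheight_eq_add_of_isPullback_of_morphismRestrict q V sG σ hσ hσV h x
    obtain ⟨c, h₂, h₃⟩ := Flat.exists_mem_fiber (IsPullback.of_hasPullback Φ g) sX _ hz
    have h₄ := coheight_eq_add_of_isClosed _ hm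
    rw [hdG _ (by simpa [q, Scheme.Hom.comp_apply] using hγ), h₂, hdZ _ hz] at h₁
    rw [h₄, hdY _ hy, hdG _ hγ, hdX _ hgz] at h₃
    refine ENat.add_right_injective_of_ne_top (ENat.natCast_ne_top dG) ?_
    calc (dG : ℕ∞) + (Order.coheight x + dX) = (dG + Order.coheight x) + dX := by ring
      _ = dZ + (dX + c) := by rw [← h₁]; ring
      _ = _ := by rw [← h₃]; ring
  have := LocallyOfFiniteType.jacobsonSpace t
  obtain ⟨x₀, -, hx₀⟩ := nonempty_inter_closedPoints (X := F)
    ⟨hW.1.nonempty.some, Set.mem_univ _⟩ isClosed_univ.isLocallyClosed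
  rw [topologicalKrullDim_eq_of_mem_irreducibleComponents t (n := Order.coheight x₀)
    (fun x hx ↦ ENat.add_left_injective_of_ne_top (ENat.natCast_ne_top dX) ((key x hx).trans (key x₀ hx₀).symm))
    hW, hX, hY, hZ]
  exact_mod_cast congr((($(key x₀ hx₀) : ℕ∞) : WithBot ℕ∞))

end AlgebraicGeometry

namespace AlgebraicGeometry

/-- A property of orbit maps of a transitive action that holds over a nonempty open subset holds
everywhere. -/
theorem of_morphismRestrict_orbitMap {k : Type} [Field k] [IsAlgClosed k] {G X Y : Scheme.{0}}
    {sG : G ⟶ Spec (.of k)} {sX : X ⟶ Spec (.of k)} [LocallyOfFiniteType sG]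
    [LocallyOfFiniteType sX] {mul : pullback sG sG ⟶ G} {e : Spec (.of k) ⟶ G}
    {act : pullback sG sX ⟶ X} (P : MorphismProperty Scheme.{0}) [IsZariskiLocalAtTarget P]
    [P.IsStableUnderBaseChange] (H : IsGroupAction sG mul e sX act)
    (Hmul : IsGroupAction sG mul e sG mul) (he : e ≫ sG = 𝟙 _) {inv : G ⟶ G}
    (hinvS : inv ≫ sG = sG)
    (hinv : ∀ (T : Scheme) (a : T ⟶ G) h, pullback.lift a (a ≫ inv) h ≫ mul = a ≫ sG ≫ e)
    (htrans : Function.Surjective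
      (pullback.lift (f := sX) (g := sX) act (pullback.snd sG sX) H.comp_eq))
    (f : Y ⟶ X) {V : X.Opens} (hV : (V : Set X).Nonempty) (hP : P (orbitMap act f ∣_ V)) :
    P (orbitMap act f) := by
  refine of_morphismRestrict_of_homogeneous P _ sX V hV hP fun x v hx hv ↦ ?_
  obtain ⟨h, hh, hxv⟩ := exists_translation_apply_eq H.comp_eq htrans hx hv
  have := H.isIso_translation he hinvS hinv h hh
  have := Hmul.isIso_translation he hinvS hinv h hh
  exact ⟨_, _, ‹_›, pullback.map_isIso .., H.map_translation_comp_orbitMap Hmul f h hh, hxv⟩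

end AlgebraicGeometry

theorem kleiman_transversality
    (k : Type) [Field k] [IsAlgClosed k] [CharZero k]
    (G X Y Z : Scheme)
    (sG : G ⟶ Spec (CommRingCat.of k)) (sX : X ⟶ Spec (CommRingCat.of k))
    (sY : Y ⟶ Spec (CommRingCat.of k)) (sZ : Z ⟶ Spec (CommRingCat.of k))
    -- everything is an algebraic scheme, i.e. of finite type over `k`
    [LocallyOfFiniteType sG] [QuasiCompact sG]
    [LocallyOfFiniteType sX] [QuasiCompact sX]
    [LocallyOfFiniteType sY] [QuasiCompact sY]
    [LocallyOfFiniteType sZ] [QuasiCompact sZ]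
    (hG : IsIntegral G) (hX : IsIntegral X) (hY : IsIntegral Y) (hZ : IsIntegral Z)
    -- group scheme structure on `G` over `k`
    (mul : pullback sG sG ⟶ G)
    (hmulS : mul ≫ sG = pullback.fst sG sG ≫ sG)
    (e : Spec (CommRingCat.of k) ⟶ G) (heS : e ≫ sG = 𝟙 _)
    (inv : G ⟶ G) (hinvS : inv ≫ sG = sG)
    (hassoc : ∀ (T : Scheme) (a b c : T ⟶ G) (hab : a ≫ sG = b ≫ sG)
      (hbc : b ≫ sG = c ≫ sG) h₁ h₂,
      pullback.lift (pullback.lift a b hab ≫ mul) c h₁ ≫ mul =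
        pullback.lift a (pullback.lift b c hbc ≫ mul) h₂ ≫ mul)
    (hone : ∀ (T : Scheme) (a : T ⟶ G) h,
      pullback.lift (a ≫ sG ≫ e) a h ≫ mul = a)
    (hone' : ∀ (T : Scheme) (a : T ⟶ G) h,
      pullback.lift a (a ≫ sG ≫ e) h ≫ mul = a)
    (hinv : ∀ (T : Scheme) (a : T ⟶ G) h,
      pullback.lift a (a ≫ inv) h ≫ mul = a ≫ sG ≫ e)
    -- action of `G` on `X` over `k`
    (act : pullback sG sX ⟶ X)
    (hactS : act ≫ sX = pullback.snd sG sX ≫ sX)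
    (hact1 : ∀ (T : Scheme) (x : T ⟶ X) h,
      pullback.lift (x ≫ sX ≫ e) x h ≫ act = x)
    (hactmul : ∀ (T : Scheme) (a b : T ⟶ G) (x : T ⟶ X) (hab : a ≫ sG = b ≫ sG)
      (hbx : b ≫ sG = x ≫ sX) h₁ h₂,
      pullback.lift (pullback.lift a b hab ≫ mul) x h₁ ≫ act =
        pullback.lift a (pullback.lift b x hbx ≫ act) h₂ ≫ act)
    -- the action is transitive: `(g, x) ↦ (g·x, x)` is surjective
    (htrans : ∀ h : act ≫ sX = pullback.snd sG sX ≫ sX,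
      Function.Surjective
        ⇑(pullback.lift (f := sX) (g := sX) act (pullback.snd sG sX) h).base)
    (f : Y ⟶ X) (g : Z ⟶ X) (hf : f ≫ sX = sY) (hg : g ≫ sX = sZ) :
    -- first conclusion: generic equidimensionality of `(σY) ×_X Z`
    (∃ U : Opens G, Dense (U : Set G) ∧
      ∀ (σ : Spec (CommRingCat.of k) ⟶ G), σ ≫ sG = 𝟙 _ →
        (∀ p, σ.base p ∈ U) →
        ∀ (w : (f ≫ sX ≫ σ) ≫ sG = f ≫ sX),
          IsEmpty (pullback (pullback.lift (f ≫ sX ≫ σ) f w ≫ act) g : Scheme) ∨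
          (∀ W ∈ irreducibleComponents
              (pullback (pullback.lift (f ≫ sX ≫ σ) f w ≫ act) g : Scheme),
            topologicalKrullDim W + topologicalKrullDim X =
              topologicalKrullDim Y + topologicalKrullDim Z)) ∧
    -- second conclusion: generic regularity when `Y` and `Z` are regular
    (RegularScheme Y → RegularScheme Z →
      ∃ U : Opens G, Dense (U : Set G) ∧
        ∀ (σ : Spec (CommRingCat.of k) ⟶ G), σ ≫ sG = 𝟙 _ →
          (∀ p, σ.base p ∈ U) →
          ∀ (w : (f ≫ sX ≫ σ) ≫ sG = f ≫ sX),
            RegularScheme (pullback (pullback.lift (f ≫ sX ≫ σ) f w ≫ act) g : Scheme)) := by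
  subst hf hg
  have := LocallyOfFiniteType.isLocallyNoetherian sG
  have := LocallyOfFiniteType.isLocallyNoetherian sX
  have := LocallyOfFiniteType.isLocallyNoetherian (f ≫ sX)
  have := LocallyOfFiniteType.isLocallyNoetherian (g ≫ sX)
  have : LocallyOfFiniteType g := locallyOfFiniteType_of_comp g sX
  have : CompactSpace G := QuasiCompact.compactSpace_of_compactSpace sG
  have : CompactSpace X := QuasiCompact.compactSpace_of_compactSpace sX
  have : CompactSpace Z := QuasiCompact.compactSpace_of_compactSpace (g ≫ sX)
  have : IsNoetherian G := {}
  have : IsNoetherian X := {}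
  have : IsNoetherian Z := {}
  have : QuasiCompact g := quasiCompact_of_noetherianSpace_source g
  have H : IsGroupAction sG mul e sX act := ⟨hactS, hact1, hactmul⟩
  have Hmul : IsGroupAction sG mul e sG mul :=
    ⟨by rw [hmulS, pullback.condition], hone, hassoc⟩
  let Φ := orbitMap act f
  have hΦ : Φ ≫ sX = pullback.fst sG (f ≫ sX) ≫ sG := by
    simp [Φ, orbitMap, hactS, pullback.lift_snd_assoc, pullback.condition]
  have : LocallyOfFiniteType (Φ ≫ sX) := hΦ ▸ inferInstance
  have : LocallyOfFiniteType Φ := locallyOfFiniteType_of_comp Φ sX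
  have := LocallyOfFiniteType.isLocallyNoetherian (pullback.fst sG (f ≫ sX) ≫ sG)
  have : CompactSpace ↑(pullback sG (f ≫ sX)) :=
    QuasiCompact.compactSpace_of_compactSpace (pullback.fst sG (f ≫ sX) ≫ sG)
  have : IsNoetherian (pullback sG (f ≫ sX)) := {}
  have : QuasiCompact Φ := quasiCompact_of_noetherianSpace_source Φ
  let q := pullback.fst Φ g ≫ pullback.fst sG (f ≫ sX)
  constructor
  · obtain ⟨V, hV, hΦV⟩ := Flat.exists_morphismRestrict Φ
    have : IsZariskiLocalAtTarget @Flat.{0} :=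
      HasRingHomProperty.instIsZariskiLocalAtTarget _
    have : Flat Φ :=
      of_morphismRestrict_orbitMap @Flat H Hmul heS hinvS hinv (htrans hactS) f hV hΦV
    obtain ⟨U, hU, hqU⟩ := Flat.exists_morphismRestrict q
    refine ⟨U, U.2.dense hU, fun σ hσ hσU w ↦ .inr fun W hW ↦ ?_⟩
    obtain ⟨i, hi⟩ := exists_isPullback_orbitMap act f g σ hσ w
    exact topologicalKrullDim_add_eq_of_flat Φ hΦ g U hσ hσU hi hW
  · intro hYreg hZreg
    have : Smooth sG := Hmul.smooth heS hinvS hinv hone'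
    have : Smooth (f ≫ sX) := Smooth.of_isRegularLocalRing_stalk _
      fun y ↦ isRegularLocal_iff_isRegularLocalRing.mp (hYreg y)
    have : Smooth (g ≫ sX) := Smooth.of_isRegularLocalRing_stalk _
      fun z ↦ isRegularLocal_iff_isRegularLocalRing.mp (hZreg z)
    obtain ⟨V, hV, hΦV⟩ := Smooth.exists_morphismRestrict Φ sX
      fun x _ ↦ Smooth.isRegularLocalRing_stalk (pullback.snd sG (f ≫ sX) ≫ f ≫ sX) x
    have : IsZariskiLocalAtTarget @Smooth.{0} :=
      HasRingHomProperty.instIsZariskiLocalAtTarget _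
    have : Smooth Φ :=
      of_morphismRestrict_orbitMap @Smooth H Hmul heS hinvS hinv (htrans hactS) f hV hΦV
    obtain ⟨U, hU, hqU⟩ := Smooth.exists_morphismRestrict q sG
      fun x _ ↦ Smooth.isRegularLocalRing_stalk (pullback.snd Φ g ≫ g ≫ sX) x
    refine ⟨U, U.2.dense hU, fun σ hσ hσU w x ↦ ?_⟩
    obtain ⟨i, hi⟩ := exists_isPullback_orbitMap act f g σ hσ w
    obtain ⟨i', σ', -, -, hi'⟩ := isPullback_of_morphismRestrict hi U hσU
    have : Smooth (pullback.fst (pullback.lift (f ≫ sX ≫ σ) f w ≫ act) g ≫ f ≫ sX) :=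
      MorphismProperty.of_isPullback hi' hqU
    exact isRegularLocal_iff_isRegularLocalRing.mpr (Smooth.isRegularLocalRing_stalk
      (pullback.fst (pullback.lift (f ≫ sX ≫ σ) f w ≫ act) g ≫ f ≫ sX) x)

end
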